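/- Let λ be the Liouville function and set a_n = 1 + λ(n) for n ≥ 1 (Selberg's example). Then: (a) for every ν ∈ (0,1) and every B > 0 there is a constant C (depending on ν, B) such that ∑_{d ≤ x^ν} |∑_{n ≤ x, d|n} a_n − x/d| ≤ C·x·(log x)^{−B} for all x ≥ 2 (i.e. condition R(ν) holds for every ν < 1); and (b) ∑_{n ≤ x} a_n Λ(n) = O(√x), where Λ is the von Mangoldt function. -/

import Mathlib

open Finset Filter

/-- The generalized von Mangoldt function `Λ_k(n) = ∑_{d ∣ n} μ(d) (log (n/d))^k`. -/
noncomputable def Lambdak (k : ℕ) (n : ℕ) : ℝ :=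
  ∑ d ∈ n.divisors, (ArithmeticFunction.moebius d : ℝ) * (Real.log ((n : ℝ) / (d : ℝ))) ^ k

/-- `S_k(x) = ∑_{n ≤ x} a_n Λ_k(n)`. -/
noncomputable def Ssum (a : ℕ → ℝ) (k : ℕ) (x : ℝ) : ℝ :=
  ∑ n ∈ Finset.Icc 1 ⌊x⌋₊, a n * Lambdak k n

/-- `T_k(x) = S_k(x)/(k x (log x)^{k−1})`. -/
noncomputable def Tquot (a : ℕ → ℝ) (k : ℕ) (x : ℝ) : ℝ :=
  Ssum a k x / (k * x * Real.log x ^ (k - 1))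

/-- Condition `R(ν)`: for every `B > 0` there is `C_B` with
`∑_{d ≤ x^ν} |∑_{n ≤ x, d ∣ n} a_n − x/d| ≤ C_B · x (log x)^{−B}` for all `x ≥ 2`. -/
noncomputable def Rcond (ν : ℝ) (a : ℕ → ℝ) : Prop :=
  ∀ B : ℝ, 0 < B → ∃ C : ℝ, ∀ x : ℝ, 2 ≤ x →
    ∑ d ∈ Finset.Icc 1 ⌊x ^ ν⌋₊,
      |(∑ n ∈ (Finset.Icc 1 ⌊x⌋₊).filter (fun n => d ∣ n), a n) - x / d|
      ≤ C * x * Real.log x ^ (-B)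

/-- The Liouville function `λ(n) = (−1)^{Ω(n)}`. -/
noncomputable def liouville (n : ℕ) : ℝ := (-1 : ℝ) ^ (ArithmeticFunction.cardFactors n)

namespace SelbergEx
open Complex

noncomputable def gt (n : ℕ) (s : ℂ) : ℂ :=
  ((n + 1 : ℕ) : ℂ) ^ (-s) - (((n + 2 : ℕ) : ℂ) ^ (1 - s) - ((n + 1 : ℕ) : ℂ) ^ (1 - s)) / (1 - s)

lemma gt_bound (n : ℕ) (s : ℂ) (hs : 0 < s.re) (h1 : s ≠ 1) :
    ‖gt n s‖ ≤ ‖s‖ * ((n + 1 : ℕ) : ℝ) ^ (-s.re - 1) := by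
  have hint : ∫ u in ((n + 1 : ℕ) : ℝ)..((n + 2 : ℕ) : ℝ), (u : ℂ) ^ (-s) =
      (((n + 2 : ℕ) : ℂ) ^ (1 - s) - ((n + 1 : ℕ) : ℂ) ^ (1 - s)) / (1 - s) := by
    rw [integral_cpow]
    · push_cast
      ring_nf
    · right
      refine ⟨fun h => h1 (by linear_combination -h), ?_⟩
      rw [Set.uIcc_of_le (by push_cast; linarith)]
      intro h
      have := h.1
      push_cast at this
      have : (0:ℝ) ≤ n := Nat.cast_nonneg n
      linarith
  have hn : (0:ℝ) ≤ n := Nat.cast_nonneg n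
  have hle : ((n + 1 : ℕ) : ℝ) ≤ ((n + 2 : ℕ) : ℝ) := by push_cast; linarith
  have hpos : ∀ u ∈ Set.Icc ((n + 1 : ℕ) : ℝ) ((n + 2 : ℕ) : ℝ), 0 < u := by
    intro u hu
    have := hu.1
    push_cast at this
    linarith
  have hcont : ContinuousOn (fun u : ℝ => (u : ℂ) ^ (-s)) (Set.uIcc ((n + 1 : ℕ) : ℝ) ((n + 2 : ℕ) : ℝ)) := by
    rw [Set.uIcc_of_le hle]
    intro u hu
    apply ContinuousAt.continuousWithinAt
    have : (u : ℂ) ∈ slitPlane := by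
      left; simpa using hpos u hu
    exact ContinuousAt.cpow (by fun_prop) (by fun_prop) this
  have hconst : ((n + 1 : ℕ) : ℂ) ^ (-s) = ∫ u in ((n + 1 : ℕ) : ℝ)..((n + 2 : ℕ) : ℝ), ((n + 1 : ℕ) : ℂ) ^ (-s) := by
    rw [intervalIntegral.integral_const]
    push_cast
    ring_nf
    simp
  have hg : gt n s = ∫ u in ((n + 1 : ℕ) : ℝ)..((n + 2 : ℕ) : ℝ),
      (((n + 1 : ℕ) : ℂ) ^ (-s) - (u : ℂ) ^ (-s)) := by
    rw [intervalIntegral.integral_sub (by simp) hcont.intervalIntegrable, ← hconst, hint, gt]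
  rw [hg]
  have := intervalIntegral.norm_integral_le_of_norm_le_const (a := ((n + 1 : ℕ) : ℝ))
    (b := ((n + 2 : ℕ) : ℝ)) (f := fun u : ℝ => ((n + 1 : ℕ) : ℂ) ^ (-s) - (u : ℂ) ^ (-s))
    (C := ‖s‖ * ((n + 1 : ℕ) : ℝ) ^ (-s.re - 1)) ?_
  · refine this.trans (le_of_eq ?_)
    have : |((n + 2 : ℕ) : ℝ) - ((n + 1 : ℕ) : ℝ)| = 1 := by
      push_cast; rw [abs_of_nonneg] <;> linarith
    rw [this, mul_one]
  · intro u hu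
    rw [Set.uIoc_of_le hle] at hu
    have key := Convex.norm_image_sub_le_of_norm_hasDerivWithin_le
      (f := fun v : ℝ => (v : ℂ) ^ (-s)) (f' := fun v : ℝ => (-s) * (v : ℂ) ^ (-s - 1))
      (s := Set.Icc ((n + 1 : ℕ) : ℝ) ((n + 2 : ℕ) : ℝ)) (C := ‖s‖ * ((n + 1 : ℕ) : ℝ) ^ (-s.re - 1))
      (x := u) (y := ((n + 1 : ℕ) : ℝ)) ?_ ?_ (convex_Icc _ _) ⟨hu.1.le, hu.2⟩ ⟨le_rfl, hle⟩
    · refine le_trans ?_ (key.trans ?_)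
      · simp
      · have h3 : ‖((n + 1 : ℕ) : ℝ) - u‖ ≤ 1 := by
          have := hu.1; have := hu.2
          push_cast at *
          rw [Real.norm_eq_abs, abs_le]; constructor <;> linarith
        exact mul_le_of_le_one_right (by positivity) h3
    · intro v hv
      apply HasDerivAt.hasDerivWithinAt
      have hne : -s ≠ 0 := by
        intro h
        have : s = 0 := by simpa using h
        rw [this] at hs; simp at hs
      exact hasDerivAt_ofReal_cpow_const (hpos v hv).ne' hne |>.congr_deriv (by ring) |> fun h => h
    · intro v hv
      rw [norm_mul, norm_neg, norm_cpow_eq_rpow_re_of_pos (hpos v hv)]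
      gcongr
      simp only [sub_re, neg_re, one_re]
      apply Real.rpow_le_rpow_of_nonpos (by positivity) hv.1 (by linarith)

lemma gt_partial (N : ℕ) (s : ℂ) (h1 : s ≠ 1) :
    1 / (s - 1) + ∑ n ∈ range N, gt n s =
      ∑ n ∈ range N, ((n + 1 : ℕ) : ℂ) ^ (-s) + ((N + 1 : ℕ) : ℂ) ^ (1 - s) / (s - 1) := by
  have h2 : s - 1 ≠ 0 := sub_ne_zero.mpr h1
  have h3 : 1 - s ≠ 0 := sub_ne_zero.mpr h1.symm
  induction N with
  | zero => simp
  | succ N ih =>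
    rw [sum_range_succ, ← add_assoc, ih, sum_range_succ, gt]
    have : (1 - s) = -(s - 1) := by ring
    rw [show N + 1 + 1 = N + 2 by rfl, div_eq_mul_inv _ (1 - s), this, inv_neg]
    ring

lemma gt_summable (s : ℂ) (hs : 0 < s.re) (h1 : s ≠ 1) : Summable (fun n => gt n s) := by
  refine Summable.of_norm_bounded ?_ (fun n => gt_bound n s hs h1)
  apply Summable.mul_left
  exact (summable_nat_add_iff 1).mpr (Real.summable_nat_rpow.mpr (by linarith))

lemma zeta_eq_gt_of_one_lt (s : ℂ) (hs : 1 < s.re) :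
    riemannZeta s = 1 / (s - 1) + ∑' n, gt n s := by
  have h1 : s ≠ 1 := by rintro rfl; simp at hs
  have hsum := (gt_summable s (by linarith) h1).hasSum.tendsto_sum_nat.const_add (1 / (s - 1))
  have hz : Tendsto (fun N => ∑ n ∈ range N, ((n + 1 : ℕ) : ℂ) ^ (-s)) atTop (nhds (riemannZeta s)) := by
    have hS : Summable (fun n : ℕ => ((n + 1 : ℕ) : ℂ) ^ (-s)) := by
      have := (summable_nat_add_iff 1).mpr (Complex.summable_one_div_nat_cpow.mpr hs)
      refine this.congr fun n => ?_
      rw [cpow_neg, one_div]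
    have := hS.hasSum.tendsto_sum_nat
    convert this using 2
    rw [zeta_eq_tsum_one_div_nat_add_one_cpow hs]
    congr 1
    ext n
    rw [cpow_neg, one_div]; push_cast; rfl
  have hz2 : Tendsto (fun N : ℕ => ((N + 1 : ℕ) : ℂ) ^ (1 - s) / (s - 1)) atTop (nhds 0) := by
    rw [← zero_div (s - 1)]
    apply Tendsto.div_const
    rw [tendsto_zero_iff_norm_tendsto_zero]
    have : ∀ N : ℕ, ‖((N + 1 : ℕ) : ℂ) ^ (1 - s)‖ = ((N + 1 : ℕ) : ℝ) ^ (-(s.re - 1)) := by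
      intro N
      rw [norm_natCast_cpow_of_pos (Nat.succ_pos N)]
      simp
    simp_rw [this]
    exact (tendsto_rpow_neg_atTop (by linarith : 0 < s.re - 1)).comp
      (tendsto_natCast_atTop_atTop.comp (tendsto_add_atTop_nat 1))
  have := hz.add hz2
  rw [add_zero] at this
  refine tendsto_nhds_unique this (hsum.congr fun N => ?_)
  rw [gt_partial N s h1]

lemma gt_diff (n : ℕ) (s : ℂ) (h1 : s ≠ 1) : DifferentiableAt ℂ (gt n) s := by
  have h3 : 1 - s ≠ 0 := sub_ne_zero.mpr h1.symm
  have a1 : ((n + 1 : ℕ) : ℂ) ≠ 0 := by exact_mod_cast Nat.succ_ne_zero n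
  have a2 : ((n + 2 : ℕ) : ℂ) ≠ 0 := by exact_mod_cast Nat.succ_ne_zero (n+1)
  unfold gt
  refine DifferentiableAt.sub ?_ (DifferentiableAt.div (DifferentiableAt.sub ?_ ?_) (by fun_prop) h3)
  · exact DifferentiableAt.const_cpow (by fun_prop) (Or.inl a1)
  · exact DifferentiableAt.const_cpow (by fun_prop) (Or.inl a2)
  · exact DifferentiableAt.const_cpow (by fun_prop) (Or.inl a1)

lemma zeta_eq_gt (s : ℂ) (hs : 0 < s.re) (ht : 0 < s.im) :
    riemannZeta s = 1 / (s - 1) + ∑' n, gt n s := by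
  set U : Set ℂ := {z | 0 < z.re} ∩ {z | 0 < z.im} with hU
  have hUo : IsOpen U := (isOpen_lt continuous_const continuous_re).inter (isOpen_lt continuous_const continuous_im)
  have hUc : Convex ℝ U := (convex_halfSpace_re_gt 0).inter (convex_halfSpace_im_gt 0)
  have hne : ∀ z ∈ U, z ≠ 1 := by
    rintro z ⟨_, hz⟩ rfl
    simp at hz
  have hd1 : AnalyticOnNhd ℂ riemannZeta U :=
    DifferentiableOn.analyticOnNhd (fun z hz => (differentiableAt_riemannZeta (hne z hz)).differentiableWithinAt) hUo
  have hd2 : AnalyticOnNhd ℂ (fun s => 1 / (s - 1) + ∑' n, gt n s) U := by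
    refine DifferentiableOn.analyticOnNhd (fun z hz => ?_) hUo
    apply DifferentiableAt.differentiableWithinAt
    refine DifferentiableAt.add ?_ ?_
    · exact DifferentiableAt.div (by fun_prop) (by fun_prop) (sub_ne_zero.mpr (hne z hz))
    · set V : Set ℂ := U ∩ ({w | z.re / 2 < w.re} ∩ Metric.ball z 1) with hV
      have hVo : IsOpen V := hUo.inter ((isOpen_lt continuous_const continuous_re).inter Metric.isOpen_ball)
      have hzV : z ∈ V := ⟨hz, by have := hz.1; simp only [Set.mem_ofPred_eq] at this ⊢; linarith, Metric.mem_ball_self one_pos⟩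
      have : DifferentiableOn ℂ (fun s => ∑' n, gt n s) V := by
        refine differentiableOn_tsum_of_summable_norm
          (u := fun n : ℕ => (‖z‖ + 1) * ((n + 1 : ℕ) : ℝ) ^ (-(z.re/2) - 1)) ?_ ?_ hVo ?_
        · apply Summable.mul_left
          have := hz.1
          simp only [Set.mem_ofPred_eq] at this
          exact (summable_nat_add_iff 1).mpr (Real.summable_nat_rpow.mpr (by linarith))
        · intro n w hw
          exact (gt_diff n w (hne w hw.1)).differentiableWithinAt
        · intro n w hw
          refine (gt_bound n w hw.1.1 (hne w hw.1)).trans ?_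
          have h1 : ‖w‖ ≤ ‖z‖ + 1 := by
            have := hw.2.2
            rw [Metric.mem_ball, dist_eq_norm] at this
            calc ‖w‖ = ‖z + (w - z)‖ := by ring_nf
              _ ≤ ‖z‖ + ‖w - z‖ := norm_add_le _ _
              _ ≤ _ := by linarith
          gcongr
          · push_cast; linarith [(Nat.cast_nonneg n : (0:ℝ) ≤ n)]
          · exact hw.2.1.le
      exact this.differentiableAt (hVo.mem_nhds hzV)
  have h0 : (2 + I) ∈ U := by simp [hU]
  refine hd1.eqOn_of_preconnected_of_eventuallyEq hd2 hUc.isPreconnected h0 ?_ ⟨hs, ht⟩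
  filter_upwards [(isOpen_lt continuous_const continuous_re : IsOpen {z : ℂ | 1 < z.re}).mem_nhds (by simp : (2 + I) ∈ {z : ℂ | 1 < z.re})] with w hw
  exact zeta_eq_gt_of_one_lt w hw

lemma zeta_strip_pos (ε : ℝ) (hε : 0 < ε) (hε1 : ε ≤ 1 / 4) : ∃ C : ℝ, 0 < C ∧ ∀ s : ℂ,
    1 - ε ≤ s.re → s.re ≤ 4 → 1 ≤ s.im → ‖riemannZeta s‖ ≤ C * s.im ^ (2 * ε) := by
  have hS : Summable (fun n : ℕ => ((n + 1 : ℕ) : ℝ) ^ (-1 - ε)) :=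
    (summable_nat_add_iff 1).mpr (Real.summable_nat_rpow.mpr (by linarith))
  set K := ∑' n : ℕ, ((n + 1 : ℕ) : ℝ) ^ (-1 - ε) with hK
  have hK0 : 0 ≤ K := tsum_nonneg fun n => by positivity
  refine ⟨2 * K + 2 + 5 * K, by positivity, fun s h1 h2 h3 => ?_⟩
  set t := s.im with ht
  have hre : 0 < s.re := by linarith
  have hs1 : s ≠ 1 := by rintro h; rw [h] at ht; simp at ht; linarith
  set N := ⌊t⌋₊ with hN
  have hNt : (N : ℝ) ≤ t := Nat.floor_le (by linarith)
  have htN : t < N + 1 := Nat.lt_floor_add_one t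
  have hN1 : 1 ≤ N := Nat.le_floor (by simpa using h3)
  have hN1' : (1:ℝ) ≤ N := by exact_mod_cast hN1
  have hsum := gt_summable s hre hs1
  rw [zeta_eq_gt s hre (by linarith), ← hsum.sum_add_tsum_nat_add N, ← add_assoc, gt_partial N s hs1]
  have e2 : t ^ ε ≤ t ^ (2 * ε) := Real.rpow_le_rpow_of_exponent_le h3 (by linarith)
  have b1 : ‖∑ n ∈ range N, ((n + 1 : ℕ) : ℂ) ^ (-s)‖ ≤ K * t ^ (2 * ε) := by
    refine (norm_sum_le _ _).trans ?_
    calc ∑ n ∈ range N, ‖((n + 1 : ℕ) : ℂ) ^ (-s)‖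
        ≤ ∑ n ∈ range N, ((n + 1 : ℕ) : ℝ) ^ (-1 - ε) * t ^ (2 * ε) := by
          refine sum_le_sum fun n hn => ?_
          rw [norm_natCast_cpow_of_pos (Nat.succ_pos n)]
          have hn1 : (1:ℝ) ≤ ((n + 1 : ℕ) : ℝ) := by exact_mod_cast Nat.succ_pos n
          have hnt : ((n + 1 : ℕ) : ℝ) ≤ t := by
            refine le_trans ?_ hNt
            exact_mod_cast mem_range.mp hn
          calc ((n + 1 : ℕ) : ℝ) ^ (-s).re ≤ ((n + 1 : ℕ) : ℝ) ^ ((-1 - ε) + 2 * ε) :=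
                Real.rpow_le_rpow_of_exponent_le hn1 (by simp; linarith)
            _ = ((n + 1 : ℕ) : ℝ) ^ (-1 - ε) * ((n + 1 : ℕ) : ℝ) ^ (2 * ε) := Real.rpow_add (by linarith) _ _
            _ ≤ _ := by gcongr
      _ = (∑ n ∈ range N, ((n + 1 : ℕ) : ℝ) ^ (-1 - ε)) * t ^ (2 * ε) := by rw [sum_mul]
      _ ≤ K * t ^ (2 * ε) := by
          gcongr
          exact hS.sum_le_tsum _ (fun n _ => by positivity)
  have b2 : ‖((N + 1 : ℕ) : ℂ) ^ (1 - s) / (s - 1)‖ ≤ 2 * t ^ (2 * ε) := by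
    rw [norm_div, norm_natCast_cpow_of_pos (Nat.succ_pos N)]
    have hd : 1 ≤ ‖s - 1‖ := by
      refine le_trans ?_ (Complex.abs_im_le_norm _)
      simp only [sub_im, one_im, sub_zero]
      rw [abs_of_pos] <;> linarith
    refine (div_le_self (by positivity) hd).trans ?_
    have hb : (1:ℝ) ≤ ((N + 1 : ℕ) : ℝ) := by push_cast; linarith
    calc ((N + 1 : ℕ) : ℝ) ^ (1 - s).re ≤ ((N + 1 : ℕ) : ℝ) ^ ε :=
          Real.rpow_le_rpow_of_exponent_le hb (by simp; linarith)
      _ ≤ (2 * t) ^ ε := by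
          apply Real.rpow_le_rpow (by linarith) _ hε.le
          push_cast; linarith
      _ = 2 ^ ε * t ^ ε := Real.mul_rpow (by norm_num) (by linarith)
      _ ≤ 2 * t ^ (2 * ε) := by
          gcongr
          exact (Real.rpow_le_rpow_of_exponent_le (by norm_num) (by linarith : ε ≤ 1)).trans (by simp)
  have b3 : ‖∑' n, gt (n + N) s‖ ≤ 5 * K * t ^ (2 * ε) := by
    have hsn : ‖s‖ ≤ 5 * t := by
      refine (Complex.norm_le_abs_re_add_abs_im s).trans ?_
      rw [abs_of_pos hre, ← ht, abs_of_pos (by linarith)]; linarith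
    have hb : ∀ n, ‖gt (n + N) s‖ ≤ ((n + 1 : ℕ) : ℝ) ^ (-1 - ε) * (5 * t * t ^ (-1 + 2 * ε)) := by
      intro n
      refine (gt_bound _ s hre hs1).trans ?_
      have hn0 : (0:ℝ) ≤ n := Nat.cast_nonneg n
      have hc1 : (1:ℝ) ≤ ((n + N + 1 : ℕ) : ℝ) := by push_cast; linarith
      have hc2 : t ≤ ((n + N + 1 : ℕ) : ℝ) := by push_cast; linarith
      have hc3 : ((n + 1 : ℕ) : ℝ) ≤ ((n + N + 1 : ℕ) : ℝ) := by push_cast; linarith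
      calc ‖s‖ * ((n + N + 1 : ℕ) : ℝ) ^ (-s.re - 1)
          ≤ (5 * t) * ((n + N + 1 : ℕ) : ℝ) ^ ((-1 - ε) + (-1 + 2 * ε)) := by
            gcongr
            linarith
        _ = (5 * t) * (((n + N + 1 : ℕ) : ℝ) ^ (-1 - ε) * ((n + N + 1 : ℕ) : ℝ) ^ (-1 + 2 * ε)) := by
            rw [Real.rpow_add (by linarith)]
        _ ≤ (5 * t) * (((n + 1 : ℕ) : ℝ) ^ (-1 - ε) * t ^ (-1 + 2 * ε)) := by
            gcongr ?_ * (?_ * ?_)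
            · exact Real.rpow_le_rpow_of_nonpos (by positivity) hc3 (by linarith)
            · exact Real.rpow_le_rpow_of_nonpos (by linarith) hc2 (by linarith)
        _ = _ := by ring
    refine (tsum_of_norm_bounded (hS.hasSum.mul_right _) hb).trans (le_of_eq ?_)
    rw [Real.rpow_add (by linarith), Real.rpow_neg_one, ← hK]
    field_simp
  calc _ ≤ ‖∑ n ∈ range N, ((n + 1 : ℕ) : ℂ) ^ (-s)‖ + ‖((N + 1 : ℕ) : ℂ) ^ (1 - s) / (s - 1)‖
        + ‖∑' n, gt (n + N) s‖ := norm_add₃_le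
    _ ≤ K * t ^ (2 * ε) + 2 * t ^ (2 * ε) + 5 * K * t ^ (2 * ε) := by gcongr
    _ ≤ _ := by
      have : 0 ≤ K * t ^ (2 * ε) := by positivity
      linarith

lemma zeta_strip (ε : ℝ) (hε : 0 < ε) (hε1 : ε ≤ 1 / 4) : ∃ C : ℝ, 0 < C ∧ ∀ s : ℂ,
    1 - ε ≤ s.re → s.re ≤ 4 → 1 ≤ |s.im| → ‖riemannZeta s‖ ≤ C * |s.im| ^ (2 * ε) := by
  obtain ⟨C, hC, h⟩ := zeta_strip_pos ε hε hε1
  refine ⟨C, hC, fun s h1 h2 h3 => ?_⟩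
  rcases le_total 0 s.im with h0 | h0
  · rw [abs_of_nonneg h0] at h3 ⊢
    exact h s h1 h2 h3
  · rw [abs_of_nonpos h0] at h3 ⊢
    have := h ((starRingEnd ℂ) s) (by simpa using h1) (by simpa using h2) (by simpa using h3)
    rw [riemannZeta_conj] at this
    simpa using this

end SelbergEx

namespace SelbergEx
open Complex

lemma zeta_deriv_strip (ε : ℝ) (hε : 0 < ε) (hε1 : ε ≤ 1 / 4) : ∃ C : ℝ, 0 < C ∧ ∀ s : ℂ,
    1 - ε / 2 ≤ s.re → s.re ≤ 3 → 2 ≤ |s.im| → ‖deriv riemannZeta s‖ ≤ C * |s.im| ^ (2 * ε) := by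
  obtain ⟨C, hC, h⟩ := zeta_strip ε hε hε1
  refine ⟨2 * C / (ε / 2), by positivity, fun s h1 h2 h3 => ?_⟩
  have hw : ∀ w ∈ Metric.closedBall s (ε / 2), 1 - ε ≤ w.re ∧ w.re ≤ 4 ∧ 1 ≤ |w.im| ∧ |w.im| ≤ 2 * |s.im| := by
    intro w hw
    rw [Metric.mem_closedBall, dist_eq_norm] at hw
    have a1 := (Complex.abs_re_le_norm (w - s)).trans hw
    have a2 := (Complex.abs_im_le_norm (w - s)).trans hw
    rw [sub_re, abs_le] at a1
    rw [sub_im] at a2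
    have a3 := abs_sub_abs_le_abs_sub w.im s.im
    have a4 := abs_sub_abs_le_abs_sub s.im w.im
    rw [abs_sub_comm] at a4
    refine ⟨by linarith, by linarith, by linarith, by linarith⟩
  have hd : ∀ w ∈ Metric.closedBall s (ε / 2), DifferentiableAt ℂ riemannZeta w := by
    intro w hw'
    apply differentiableAt_riemannZeta
    rintro rfl
    have := (hw 1 hw').2.2.1
    simp at this
    linarith
  have := Complex.norm_deriv_le_of_forall_mem_sphere_norm_le (c := s) (R := ε / 2) (f := riemannZeta)
    (C := 2 * C * |s.im| ^ (2 * ε)) (by positivity) ?_ ?_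
  · refine this.trans (le_of_eq (by ring))
  · apply DifferentiableOn.diffContOnCl
    intro w hw'
    exact (hd w (Metric.closure_ball_subset_closedBall hw')).differentiableWithinAt
  · intro w hw'
    obtain ⟨b1, b2, b3, b4⟩ := hw w (Metric.sphere_subset_closedBall hw')
    refine (h w b1 b2 b3).trans ?_
    have : |w.im| ^ (2 * ε) ≤ 2 * |s.im| ^ (2 * ε) := by
      calc |w.im| ^ (2 * ε) ≤ (2 * |s.im|) ^ (2 * ε) := Real.rpow_le_rpow (abs_nonneg _) b4 (by linarith)
        _ = 2 ^ (2 * ε) * |s.im| ^ (2 * ε) := Real.mul_rpow (by norm_num) (abs_nonneg _)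
        _ ≤ 2 * |s.im| ^ (2 * ε) := by
          gcongr
          exact (Real.rpow_le_rpow_of_exponent_le (by norm_num) (by linarith : 2 * ε ≤ 1)).trans (by simp)
    calc C * |w.im| ^ (2 * ε) ≤ C * (2 * |s.im| ^ (2 * ε)) := by gcongr
      _ = _ := by ring

lemma zeta_341 (σ t : ℝ) (hσ : 1 < σ) :
    1 ≤ ‖riemannZeta σ‖ ^ 3 * ‖riemannZeta (σ + t * I)‖ ^ 4 * ‖riemannZeta (σ + (2 * t : ℝ) * I)‖ := by
  have := DirichletCharacter.norm_LFunction_product_ge_one (N := 1) 1 (x := σ - 1) (by linarith) t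
  rw [one_pow, DirichletCharacter.LFunctionTrivChar, DirichletCharacter.LFunction_modOne_eq, norm_mul, norm_mul, norm_pow, norm_pow] at this
  have e1 : (1 + ((σ - 1 : ℝ) : ℂ)) = σ := by push_cast; ring
  rw [e1, show (σ : ℂ) + I * t = σ + t * I by ring, show (σ : ℂ) + 2 * I * t = σ + (2 * t : ℝ) * I by push_cast; ring] at this
  exact this

lemma zeta_pole : ∃ C : ℝ, 0 < C ∧ ∀ σ : ℝ, 1 < σ → σ ≤ 3 → ‖riemannZeta σ‖ ≤ C / (σ - 1) := by
  have hc : ContinuousOn riemannZeta₁ (Metric.closedBall 1 2) := differentiable_riemannZeta₁.continuous.continuousOn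
  obtain ⟨C, hC⟩ := (isCompact_closedBall (1:ℂ) 2).exists_bound_of_continuousOn hc
  refine ⟨max C 1, by positivity, fun σ h1 h2 => ?_⟩
  have hne : (σ : ℂ) ≠ 1 := by
    intro h
    have : σ = 1 := by exact_mod_cast h
    linarith
  have e : ‖(σ : ℂ) - 1‖ = σ - 1 := by
    rw [← ofReal_one, ← ofReal_sub, norm_real, Real.norm_of_nonneg (by linarith)]
  rw [riemannZeta_eq_inv_sub_mul hne, norm_mul, norm_inv, e, inv_mul_eq_div]
  have : 0 < σ - 1 := by linarith
  gcongr
  refine (hC σ ?_).trans (le_max_left _ _)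
  rw [Metric.mem_closedBall, dist_eq_norm, e]
  linarith

lemma zeta_lower (η : ℝ) (hη : 0 < η) (hη1 : η ≤ 1) : ∃ c : ℝ, 0 < c ∧ c ≤ 1 / 4 ∧ ∀ s : ℂ,
    1 - c * |s.im| ^ (-η) ≤ s.re → s.re ≤ 5 / 2 → 2 ≤ |s.im| → c * |s.im| ^ (-η) ≤ ‖riemannZeta s‖ := by
  set ε := η / 10 with hε
  have hε0 : 0 < ε := by positivity
  obtain ⟨C1, hC1, h1⟩ := zeta_strip ε hε0 (by linarith)
  obtain ⟨C2, hC2, h2⟩ := zeta_deriv_strip ε hε0 (by linarith)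
  obtain ⟨C3, hC3, h3⟩ := zeta_pole
  -- constants
  set a := 1 / (C3 ^ 3 * (C1 * 2)) with ha
  have ha0 : 0 < a := by positivity
  set c0 := min (ε / 2) (a / (256 * C2 ^ 4)) with hc0
  have hc00 : 0 < c0 := by positivity
  have hc0ε : c0 ≤ ε / 2 := min_le_left _ _
  have hc0a : 256 * C2 ^ 4 * c0 ≤ a := by
    have : c0 ≤ a / (256 * C2 ^ 4) := min_le_right _ _
    rw [le_div_iff₀ (by positivity)] at this
    linarith
  -- lower bound in terms of distance
  have key : ∀ σ t : ℝ, 1 < σ → σ ≤ 3 → 2 ≤ |t| →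
      a * (σ - 1) ^ 3 / |t| ^ (2 * ε) ≤ ‖riemannZeta (σ + t * I)‖ ^ 4 := by
    intro σ t hσ hσ3 ht
    have k1 := zeta_341 σ t hσ
    have k2 := h3 σ hσ hσ3
    have k3 := h1 (σ + (2 * t : ℝ) * I) (by simp; linarith) (by simp; linarith) (by
      simp [abs_mul]; linarith)
    have im2 : ((σ : ℂ) + (2 * t : ℝ) * I).im = 2 * t := by simp
    rw [im2] at k3
    have k4 : |2 * t| ^ (2 * ε) ≤ 2 * |t| ^ (2 * ε) := by
      rw [abs_mul, abs_two, Real.mul_rpow (by norm_num) (abs_nonneg _)]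
      gcongr
      exact (Real.rpow_le_rpow_of_exponent_le (by norm_num) (by linarith : 2 * ε ≤ 1)).trans (by simp)
    have hσ0 : 0 < σ - 1 := by linarith
    have ht0 : 0 < |t| ^ (2 * ε) := Real.rpow_pos_of_pos (by linarith) _
    set z := ‖riemannZeta (σ + t * I)‖ ^ 4 with hz
    have hz0 : 0 ≤ z := by positivity
    have k5 : 1 ≤ (C3 / (σ - 1)) ^ 3 * z * (C1 * (2 * |t| ^ (2 * ε))) := by
      refine k1.trans ?_
      gcongr
      exact k3.trans (by gcongr)
    rw [ha, div_le_iff₀ ht0, div_mul_eq_mul_div, one_mul, div_le_iff₀ (by positivity)]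
    have k6 : (C3 / (σ - 1)) ^ 3 * z * (C1 * (2 * |t| ^ (2 * ε))) * (σ - 1) ^ 3 =
        z * |t| ^ (2 * ε) * (C3 ^ 3 * (C1 * 2)) := by
      field_simp
    rw [← k6]
    exact le_mul_of_one_le_left (by positivity) k5
  refine ⟨min c0 (2 * C2 * c0), by positivity, ?_, ?_⟩
  · refine (min_le_left _ _).trans ?_
    linarith
  intro s hs1 hs2 hs3
  set t := s.im with ht
  set T := |t| ^ ε with hT
  have hT1 : 1 ≤ T := Real.one_le_rpow (by linarith) hε0.le
  have hT2 : |t| ^ (2 * ε) = T ^ 2 := by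
    rw [hT, ← Real.rpow_natCast, ← Real.rpow_mul (abs_nonneg _)]; norm_num; ring_nf
  have hTη : |t| ^ (-η) = (T ^ 10)⁻¹ := by
    rw [hT, ← Real.rpow_natCast, ← Real.rpow_mul (abs_nonneg _), ← Real.rpow_neg (abs_nonneg _)]
    congr 1; rw [hε]; push_cast; ring
  set δ := c0 * (T ^ 10)⁻¹ with hδ
  have hδ0 : 0 < δ := by positivity
  have hTi : (T ^ 10)⁻¹ ≤ 1 := inv_le_one_of_one_le₀ (one_le_pow₀ hT1)
  have hδc : δ ≤ c0 := mul_le_of_le_one_right hc00.le hTi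
  have hsδ : 1 - δ ≤ s.re := by
    refine le_trans ?_ hs1
    rw [hTη, hδ]
    gcongr
    exact min_le_left _ _
  have htarget : min c0 (2 * C2 * c0) * |t| ^ (-η) ≤ 2 * C2 * δ * T ^ 2 := by
    rw [hTη, hδ]
    calc min c0 (2 * C2 * c0) * (T ^ 10)⁻¹ ≤ (2 * C2 * c0) * (T ^ 10)⁻¹ := by
          gcongr; exact min_le_right _ _
      _ = 2 * C2 * (c0 * (T ^ 10)⁻¹) * 1 := by ring
      _ ≤ _ := by gcongr; exact one_le_pow₀ hT1
  have low : ∀ σ : ℝ, 1 + δ ≤ σ → σ ≤ 3 → 4 * C2 * δ * T ^ 2 ≤ ‖riemannZeta (σ + t * I)‖ := by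
    intro σ hσ hσ3
    have k := key σ t (by linarith) hσ3 hs3
    rw [hT2] at k
    refine le_of_pow_le_pow_left₀ (n := 4) (by norm_num) (norm_nonneg _) (le_trans ?_ k)
    rw [le_div_iff₀ (by positivity)]
    calc (4 * C2 * δ * T ^ 2) ^ 4 * T ^ 2 = (256 * C2 ^ 4 * (δ * T ^ 10)) * δ ^ 3 := by ring
      _ = (256 * C2 ^ 4 * c0) * δ ^ 3 := by
        have : δ * T ^ 10 = c0 := by rw [hδ]; field_simp
        rw [this]
      _ ≤ a * (σ - 1) ^ 3 := by
        gcongr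
        linarith
  have hst : ((s.re : ℝ) : ℂ) + t * I = s := by rw [ht]; exact re_add_im s
  refine htarget.trans ?_
  rcases le_total (1 + δ) s.re with hcase | hcase
  · have := low s.re hcase (by linarith)
    rw [hst] at this
    have : 0 ≤ 2 * C2 * δ * T ^ 2 := by positivity
    linarith
  · set w : ℂ := ((1 + δ : ℝ) : ℂ) + t * I with hw
    have hw1 := low (1 + δ) le_rfl (by linarith)
    rw [← hw] at hw1
    have hwre : w.re = 1 + δ := by simp [hw]
    have hwim : w.im = t := by simp [hw]
    have mv := Convex.norm_image_sub_le_of_norm_deriv_le (𝕜 := ℂ) (f := riemannZeta)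
      (C := C2 * T ^ 2) (s := {z : ℂ | 1 - ε/2 ≤ z.re} ∩ ({z : ℂ | z.re ≤ 3} ∩ {z : ℂ | z.im = t}))
      (x := w) (y := s) ?_ ?_ ?_ ?_ ?_
    · have hn : ‖s - w‖ ≤ 2 * δ := by
        have : s - w = ((s.re - (1 + δ) : ℝ) : ℂ) := by
          apply Complex.ext
          · simp [hwre]
          · simp [hwim]; rw [ht]; ring
        rw [this, norm_real, Real.norm_eq_abs, abs_le]
        constructor <;> linarith
      have h5 : ‖riemannZeta s - riemannZeta w‖ ≤ C2 * T ^ 2 * (2 * δ) := mv.trans (by gcongr)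
      have h6 := norm_sub_norm_le (riemannZeta w) (riemannZeta s)
      rw [norm_sub_rev] at h6
      linarith
    · rintro z ⟨hz1, hz2, hz3⟩
      apply differentiableAt_riemannZeta
      rintro rfl
      simp at hz3
      rw [← hz3] at hs3; simp at hs3; linarith
    · rintro z ⟨hz1, hz2, hz3⟩
      have hz3' : z.im = t := hz3
      have := h2 z hz1 hz2 (by rw [hz3']; exact hs3)
      rw [hz3', hT2] at this
      exact this
    · refine (convex_halfSpace_re_ge _).inter ((convex_halfSpace_re_le _).inter ?_)
      exact convex_hyperplane (f := Complex.im) Complex.imLm.isLinear t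
    · refine ⟨?_, ?_, hwim⟩
      · show 1 - ε/2 ≤ w.re
        rw [hwre]; linarith
      · show w.re ≤ 3
        rw [hwre]; linarith
    · refine ⟨?_, ?_, rfl⟩
      · show 1 - ε/2 ≤ s.re
        linarith
      · show s.re ≤ 3
        linarith

end SelbergEx

namespace SelbergEx
open Complex

lemma liouville_mul (m n : ℕ) (hm : m ≠ 0) (hn : n ≠ 0) :
    liouville (m * n) = liouville m * liouville n := by
  simp [liouville, ArithmeticFunction.cardFactors_mul hm hn, pow_add]

lemma abs_liouville (n : ℕ) : |liouville n| = 1 := by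
  simp [liouville]

noncomputable def lam (n : ℕ) : ℂ := ((liouville n : ℝ) : ℂ)

lemma norm_lam (n : ℕ) : ‖lam n‖ = 1 := by
  rw [lam, norm_real, Real.norm_eq_abs, abs_liouville]

noncomputable def lamHom (s : ℂ) (hs : s ≠ 0) : ℕ →*₀ ℂ where
  toFun n := lam n * (n : ℂ) ^ (-s)
  map_zero' := by
    simp [zero_cpow (neg_ne_zero.mpr hs)]
  map_one' := by simp [lam, liouville]
  map_mul' m n := by
    rcases eq_or_ne m 0 with rfl | hm
    · simp [zero_cpow (neg_ne_zero.mpr hs)]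
    rcases eq_or_ne n 0 with rfl | hn
    · simp [zero_cpow (neg_ne_zero.mpr hs)]
    simp only [lam, liouville_mul m n hm hn]
    push_cast
    rw [natCast_mul_natCast_cpow]
    ring

lemma lam_summable (s : ℂ) (hs : 1 < s.re) : LSeriesSummable lam s :=
  LSeriesSummable_of_bounded_of_one_lt_re (m := 1) (fun n _ => (norm_lam n).le) hs

lemma lam_LSeries (s : ℂ) (hs : 1 < s.re) :
    LSeries lam s = riemannZeta (2 * s) / riemannZeta s := by
  have hs0 : s ≠ 0 := by rintro rfl; simp at hs; linarith
  have hterm : ∀ n, LSeries.term lam s n = lamHom s hs0 n := by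
    intro n
    rcases eq_or_ne n 0 with rfl | hn
    · simp
    · rw [LSeries.term_of_ne_zero hn]
      simp [lamHom, cpow_neg, div_eq_mul_inv]
  have hsum : Summable (fun n => ‖lamHom s hs0 n‖) := by
    have := (lam_summable s hs).norm
    refine this.congr fun n => ?_
    rw [hterm]
  have p1 := EulerProduct.eulerProduct_completely_multiplicative_hasProd hsum
  have p2 := riemannZeta_eulerProduct_hasProd hs
  have p3 := riemannZeta_eulerProduct_hasProd (s := 2 * s) (by simp; linarith)
  have h := p1.mul p2
  have hfun : (fun p : Nat.Primes => (1 - lamHom s hs0 p)⁻¹ * (1 - (p : ℂ) ^ (-s))⁻¹) =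
      fun p : Nat.Primes => (1 - (p : ℂ) ^ (-(2 * s)))⁻¹ := by
    ext p
    have hl : lamHom s hs0 p = - (p : ℂ) ^ (-s) := by
      show lam p * (p : ℂ) ^ (-s) = _
      have : lam p = -1 := by
        simp [lam, liouville, ArithmeticFunction.cardFactors_apply_prime p.2]
      rw [this]; ring
    rw [hl, ← mul_inv]
    congr 1
    have : (p : ℂ) ^ (-(2 * s)) = (p : ℂ) ^ (-s) * (p : ℂ) ^ (-s) := by
      rw [← cpow_add _ _ (by exact_mod_cast p.2.ne_zero)]; ring_nf
    rw [this]; ring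
  rw [hfun] at h
  have he := h.unique p3
  rw [eq_div_iff (riemannZeta_ne_zero_of_one_lt_re hs), ← he]
  congr 1
  exact tsum_congr hterm

noncomputable def Hf (s : ℂ) : ℂ := riemannZeta (2 * s) / riemannZeta s

lemma zeta_two_bound : ∃ C : ℝ, 0 < C ∧ ∀ s : ℂ, 3 / 4 ≤ s.re → ‖riemannZeta (2 * s)‖ ≤ C := by
  have hS : Summable (fun n : ℕ => ((n + 1 : ℕ) : ℝ) ^ (-(3/2) : ℝ)) :=
    (summable_nat_add_iff 1).mpr (Real.summable_nat_rpow.mpr (by norm_num))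
  refine ⟨(∑' n : ℕ, ((n + 1 : ℕ) : ℝ) ^ (-(3/2) : ℝ)) + 1, ?_, fun s hs => ?_⟩
  · have : 0 ≤ ∑' n : ℕ, ((n + 1 : ℕ) : ℝ) ^ (-(3/2) : ℝ) := tsum_nonneg fun n => by positivity
    linarith
  · rw [zeta_eq_tsum_one_div_nat_add_one_cpow (by simp; linarith)]
    refine (tsum_of_norm_bounded hS.hasSum ?_).trans (by linarith)
    intro n
    have : (n : ℂ) + 1 = ((n + 1 : ℕ) : ℂ) := by push_cast; rfl
    rw [this, one_div, ← cpow_neg, norm_natCast_cpow_of_pos (Nat.succ_pos n)]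
    apply Real.rpow_le_rpow_of_exponent_le
    · exact_mod_cast Nat.succ_pos n
    · simp; linarith

lemma Hf_high (k : ℕ) : ∃ C : ℝ, 0 < C ∧ ∀ s : ℂ, 1 ≤ s.re → s.re ≤ 2 → 3 ≤ |s.im| →
    ‖iteratedDeriv k Hf s‖ ≤ C * |s.im| ^ (1 / 2 : ℝ) := by
  set η : ℝ := 1 / (2 * (k + 1)) with hη
  have hk0 : (0:ℝ) ≤ k := Nat.cast_nonneg k
  have hη0 : 0 < η := by positivity
  have hη1 : η ≤ 1 := by
    rw [hη, div_le_one (by positivity)]; linarith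
  obtain ⟨c, hc0, hc1, hc⟩ := zeta_lower η hη0 hη1
  obtain ⟨C2, hC2, h2⟩ := zeta_two_bound
  refine ⟨k.factorial * (C2 * (2 / c)) / (c / 2) ^ k, by positivity, fun s s1 s2 s3 => ?_⟩
  set t := |s.im| with ht
  have ht0 : 0 < t := by linarith
  set r := c / 2 * t ^ (-η) with hr
  have htη : 0 < t ^ (-η) := Real.rpow_pos_of_pos ht0 _
  have htη1 : t ^ (-η) ≤ 1 := Real.rpow_le_one_of_one_le_of_nonpos (by linarith) (by linarith)
  have hr0 : 0 < r := by positivity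
  have hr1 : r ≤ 1 / 8 := by
    calc r ≤ c / 2 * 1 := by rw [hr]; gcongr
      _ ≤ 1 / 8 := by linarith
  have hw : ∀ w ∈ Metric.closedBall s r, 1 - r ≤ w.re ∧ w.re ≤ 5 / 2 ∧ 2 ≤ |w.im| ∧ r ≤ c * |w.im| ^ (-η) := by
    intro w hw
    rw [Metric.mem_closedBall, dist_eq_norm] at hw
    have a1 := (Complex.abs_re_le_norm (w - s)).trans hw
    have a2 := (Complex.abs_im_le_norm (w - s)).trans hw
    rw [sub_re, abs_le] at a1
    rw [sub_im] at a2
    have a3 := abs_sub_abs_le_abs_sub w.im s.im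
    have a4 := abs_sub_abs_le_abs_sub s.im w.im
    rw [abs_sub_comm] at a4
    refine ⟨by linarith, by linarith, by linarith, ?_⟩
    have : (1 / 2 : ℝ) * t ^ (-η) ≤ |w.im| ^ (-η) := by
      calc (1 / 2 : ℝ) * t ^ (-η) ≤ 2 ^ (-η) * t ^ (-η) := by
            gcongr
            calc (1/2 : ℝ) = 2 ^ (-1 : ℝ) := by rw [Real.rpow_neg_one]; norm_num
              _ ≤ 2 ^ (-η) := Real.rpow_le_rpow_of_exponent_le (by norm_num) (by linarith)
        _ = (2 * t) ^ (-η) := (Real.mul_rpow (by norm_num) ht0.le).symm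
        _ ≤ |w.im| ^ (-η) := Real.rpow_le_rpow_of_nonpos (by linarith) (by linarith) (by linarith)
    calc r = c * ((1/2 : ℝ) * t ^ (-η)) := by rw [hr]; ring
      _ ≤ _ := by gcongr
  have hlow : ∀ w ∈ Metric.closedBall s r, r ≤ ‖riemannZeta w‖ := by
    intro w hw'
    obtain ⟨b1, b2, b3, b4⟩ := hw w hw'
    exact b4.trans (hc w (by linarith) b2 b3)
  have hd : ∀ w ∈ Metric.closedBall s r, DifferentiableAt ℂ Hf w := by
    intro w hw'
    obtain ⟨b1, b2, b3, b4⟩ := hw w hw'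
    have hne : w ≠ 1 := by
      rintro rfl
      simp at b3
      linarith
    have hne2 : 2 * w ≠ 1 := by
      intro h
      have := congrArg Complex.re h
      simp at this
      linarith
    refine DifferentiableAt.div ?_ (differentiableAt_riemannZeta hne) ?_
    · exact DifferentiableAt.comp (g := riemannZeta) (f := fun w => 2 * w) w (differentiableAt_riemannZeta hne2) (by fun_prop)
    · intro h0
      have := hlow w hw'
      rw [h0, norm_zero] at this
      linarith
  have := Complex.norm_iteratedDeriv_le_of_forall_mem_sphere_norm_le (c := s) (R := r) (f := Hf)
    (C := C2 / r) k hr0 ?_ ?_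
  · refine this.trans (le_of_eq ?_)
    rw [hr]
    have : t ^ (1 / 2 : ℝ) = (t ^ (-η))⁻¹ * ((t ^ (-η)) ^ k)⁻¹ := by
      rw [← mul_inv, ← pow_succ', ← Real.rpow_natCast, ← Real.rpow_mul ht0.le, ← Real.rpow_neg ht0.le]
      congr 1
      rw [hη]; push_cast; field_simp
    rw [this, mul_pow]
    field_simp
  · apply DifferentiableOn.diffContOnCl
    intro w hw'
    exact (hd w (Metric.closure_ball_subset_closedBall hw')).differentiableWithinAt
  · intro w hw'
    have hw'' := Metric.sphere_subset_closedBall hw'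
    obtain ⟨b1, b2, b3, b4⟩ := hw w hw''
    rw [Hf, norm_div]
    gcongr
    · exact h2 w (by linarith)
    · exact hlow w hw''

noncomputable def Hg (s : ℂ) : ℂ := (s - 1) * riemannZeta (2 * s) / riemannZeta₁ s

lemma Hf_low (k : ℕ) : ∃ C : ℝ, 0 < C ∧ ∀ s : ℂ, 1 < s.re → s.re ≤ 2 → |s.im| ≤ 3 →
    ‖iteratedDeriv k Hf s‖ ≤ C := by
  have hz1 : ∀ s : ℂ, 1 ≤ s.re → riemannZeta₁ s ≠ 0 := by
    intro s hs h0
    rcases eq_or_ne s 1 with rfl | hne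
    · simp at h0
    · have := riemannZeta_eq_inv_sub_mul hne
      rw [h0, mul_zero] at this
      exact riemannZeta_ne_zero_of_one_le_re hs this
  have han : ∀ s : ℂ, 1 ≤ s.re → AnalyticAt ℂ Hg s := by
    intro s hs
    have a1 : AnalyticAt ℂ riemannZeta₁ s := differentiable_riemannZeta₁.analyticAt s
    have hne2 : 2 * s ≠ 1 := by
      intro h
      have := congrArg Complex.re h
      simp at this
      linarith
    have a2 : AnalyticAt ℂ riemannZeta (2 * s) := by
      refine DifferentiableOn.analyticAt (s := {1}ᶜ) ?_ (isOpen_compl_singleton.mem_nhds hne2)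
      intro w hw
      exact (differentiableAt_riemannZeta hw).differentiableWithinAt
    have a3 : AnalyticAt ℂ (fun s => riemannZeta (2 * s)) s :=
      AnalyticAt.comp (g := riemannZeta) (f := fun w => 2 * w) a2 (by fun_prop)
    exact ((analyticAt_id.sub analyticAt_const).mul a3).div a1 (hz1 s hs)
  have hcont : ContinuousOn (iteratedDeriv k Hg) (Set.Icc 1 2 ×ℂ Set.Icc (-3) 3) := by
    intro s hs
    apply ContinuousAt.continuousWithinAt
    have := (han s hs.1.1)
    have hk : AnalyticAt ℂ (iteratedDeriv k Hg) s := by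
      clear hs
      induction k with
      | zero => simpa using this
      | succ k ih => rw [iteratedDeriv_succ]; exact ih.deriv
    exact hk.continuousAt
  have hcomp : IsCompact (Set.Icc (1:ℝ) 2 ×ℂ Set.Icc (-3:ℝ) 3) := isCompact_Icc.reProdIm isCompact_Icc
  obtain ⟨C, hC⟩ := hcomp.exists_bound_of_continuousOn hcont
  refine ⟨max C 1, by positivity, fun s s1 s2 s3 => ?_⟩
  have heq : Hf =ᶠ[nhds s] Hg := by
    filter_upwards [(isOpen_lt continuous_const continuous_re : IsOpen {z : ℂ | 1 < z.re}).mem_nhds s1] with w hw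
    have hne : w ≠ 1 := by
      rintro rfl
      have : (1:ℝ) < (1:ℂ).re := hw
      simp at this
    have : w - 1 ≠ 0 := sub_ne_zero.mpr hne
    have h3 := hz1 w (le_of_lt hw)
    rw [Hf, Hg, riemannZeta_eq_inv_sub_mul hne]
    field_simp
  rw [heq.iteratedDeriv_eq]
  refine (hC s ⟨⟨s1.le, s2⟩, abs_le.mp s3⟩).trans (le_max_left _ _)

lemma lam_LSeries_bound (k : ℕ) : ∃ C : ℝ, 0 < C ∧ ∀ s : ℂ, 1 < s.re → s.re ≤ 2 →
    LSeriesSummable (LSeries.logMul^[k] lam) s ∧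
    ‖LSeries (LSeries.logMul^[k] lam) s‖ ≤ C * (1 + |s.im|) ^ (1 / 2 : ℝ) := by
  obtain ⟨C1, hC1, h1⟩ := Hf_high k
  obtain ⟨C2, hC2, h2⟩ := Hf_low k
  refine ⟨C1 + C2, by positivity, fun s s1 s2 => ?_⟩
  have habs : LSeries.abscissaOfAbsConv lam ≤ 1 :=
    LSeries.abscissaOfAbsConv_le_of_forall_lt_LSeriesSummable fun y hy => lam_summable _ (by simpa using hy)
  have hlt : LSeries.abscissaOfAbsConv lam < s.re := lt_of_le_of_lt habs (by exact_mod_cast s1)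
  constructor
  · apply LSeriesSummable_of_abscissaOfAbsConv_lt_re
    rw [LSeries.absicssaOfAbsConv_logPowMul]
    exact hlt
  have hd := LSeries_iteratedDeriv k hlt
  have heq : LSeries lam =ᶠ[nhds s] Hf := by
    filter_upwards [(isOpen_lt continuous_const continuous_re : IsOpen {z : ℂ | 1 < z.re}).mem_nhds s1] with w hw
    exact lam_LSeries w hw
  have hn : ‖LSeries (LSeries.logMul^[k] lam) s‖ = ‖iteratedDeriv k Hf s‖ := by
    rw [← heq.iteratedDeriv_eq, hd]
    simp
  rw [hn]
  have hp : 1 ≤ (1 + |s.im|) ^ (1 / 2 : ℝ) := Real.one_le_rpow (by linarith [abs_nonneg s.im]) (by norm_num)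
  rcases le_total 3 |s.im| with h | h
  · refine (h1 s s1.le s2 h).trans ?_
    have : |s.im| ^ (1 / 2 : ℝ) ≤ (1 + |s.im|) ^ (1 / 2 : ℝ) := by
      apply Real.rpow_le_rpow (abs_nonneg _) (by linarith) (by norm_num)
    gcongr
    linarith
  · refine (h2 s s1 s2 h).trans ?_
    nlinarith

end SelbergEx

namespace SelbergEx
open Complex

noncomputable def kerf (u : ℝ) : ℂ :=
  Set.indicator (Set.Ioc (0:ℝ) 1) (fun _ => (1:ℂ)) u -
    Set.indicator (Set.Ioc (0:ℝ) 1) (fun t : ℝ => (t:ℂ) ^ (1:ℂ)) u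

lemma kerf_eq {u : ℝ} (hu : 0 < u) : kerf u = ((max 0 (1 - u) : ℝ) : ℂ) := by
  unfold kerf
  by_cases h : u ≤ 1
  · have hm : u ∈ Set.Ioc (0:ℝ) 1 := ⟨hu, h⟩
    rw [Set.indicator_of_mem hm, Set.indicator_of_mem hm, max_eq_right (by linarith)]
    simp
  · have hm : u ∉ Set.Ioc (0:ℝ) 1 := fun hh => h hh.2
    rw [Set.indicator_of_notMem hm, Set.indicator_of_notMem hm,
      max_eq_left (by linarith)]
    simp

lemma kerf_mellin {s : ℂ} (hs : 0 < s.re) : HasMellin kerf s (1 / s - 1 / (s + 1)) := by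
  have h1 := hasMellin_one_Ioc hs
  have h2 := hasMellin_cpow_Ioc (1:ℂ) (s := s) (by simp; linarith)
  have h3 := hasMellin_sub h1.1 h2.1
  rw [h1.2, h2.2] at h3
  exact h3

lemma F_norm {s : ℂ} (hs : 1 ≤ s.re) : ‖1 / s - 1 / (s + 1)‖ ≤ 2 * (1 + ‖s.im‖) ^ (-(2:ℝ)) := by
  have hs0 : s ≠ 0 := by rintro rfl; simp at hs; linarith
  have hs1 : s + 1 ≠ 0 := by
    intro h
    have := congrArg Complex.re h
    simp at this; linarith
  have e : 1 / s - 1 / (s + 1) = 1 / (s * (s + 1)) := by field_simp; ring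
  rw [e, norm_div, norm_one, norm_mul, Real.rpow_neg (by positivity), ← div_eq_mul_inv,
    div_le_div_iff₀ (by positivity) (by positivity), one_mul]
  norm_cast
  have n1 : ‖s‖ ^ 2 = s.re ^ 2 + s.im ^ 2 := by rw [Complex.sq_norm, normSq_apply]; ring
  have n2 : ‖s‖ ≤ ‖s + 1‖ := by
    apply le_of_sq_le_sq _ (norm_nonneg _)
    rw [n1, Complex.sq_norm, normSq_apply]; simp; nlinarith
  have n3 : 1 + s.im ^ 2 ≤ ‖s‖ * ‖s + 1‖ := by
    calc 1 + s.im ^ 2 ≤ ‖s‖ ^ 2 := by rw [n1]; nlinarith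
      _ = ‖s‖ * ‖s‖ := by ring
      _ ≤ _ := by gcongr
  have n4 : ‖s.im‖ ^ 2 = s.im ^ 2 := by simp
  nlinarith [sq_nonneg (1 - ‖s.im‖)]

lemma F_int {σ : ℝ} (hσ : 1 ≤ σ) : MeasureTheory.Integrable
    (fun y : ℝ => 1 / ((σ : ℂ) + y * I) - 1 / ((σ : ℂ) + y * I + 1)) := by
  refine MeasureTheory.Integrable.mono' (g := fun y : ℝ => 2 * (1 + ‖y‖) ^ (-(2:ℝ))) ?_ ?_ ?_
  · exact (integrable_one_add_norm (by simp)).const_mul 2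
  · have h1 : ∀ y : ℝ, (σ : ℂ) + y * I ≠ 0 := by
      intro y h
      have := congrArg Complex.re h
      simp at this; linarith
    have h2 : ∀ y : ℝ, (σ : ℂ) + y * I + 1 ≠ 0 := by
      intro y h
      have := congrArg Complex.re h
      simp at this; linarith
    apply Continuous.aestronglyMeasurable
    exact (Continuous.div (by fun_prop) (by fun_prop) h1).sub (Continuous.div (by fun_prop) (by fun_prop) h2)
  · refine Eventually.of_forall fun y => ?_
    have := F_norm (s := (σ : ℂ) + y * I) (by simpa using hσ)
    simpa using this

lemma kerf_inv {σ u : ℝ} (hσ : 1 ≤ σ) (hu : 0 < u) :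
    ∫ y : ℝ, (u : ℂ) ^ (-((σ : ℂ) + y * I)) * (1 / ((σ : ℂ) + y * I) - 1 / ((σ : ℂ) + y * I + 1)) =
      2 * Real.pi * ((max 0 (1 - u) : ℝ) : ℂ) := by
  have hm : ∀ y : ℝ, mellin kerf ((σ : ℂ) + y * I) = 1 / ((σ : ℂ) + y * I) - 1 / ((σ : ℂ) + y * I + 1) := by
    intro y
    exact (kerf_mellin (s := (σ : ℂ) + y * I) (by simp; linarith)).2
  have h := mellinInv_mellin_eq σ kerf hu (kerf_mellin (s := (σ : ℂ)) (by simp; linarith)).1 ?_ ?_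
  · rw [mellinInv, kerf_eq hu] at h
    rw [← h]
    simp only [smul_eq_mul]
    simp_rw [hm]
    have : (Real.pi : ℂ) ≠ 0 := by exact_mod_cast Real.pi_ne_zero
    rw [real_smul]
    generalize (∫ y : ℝ, (u : ℂ) ^ (-((σ : ℂ) + y * I)) * (1 / ((σ : ℂ) + y * I) - 1 / ((σ : ℂ) + y * I + 1))) = Q
    push_cast
    field_simp
  · unfold VerticalIntegrable
    simp_rw [hm]
    exact F_int hσ
  · have : (fun v : ℝ => ((max 0 (1 - v) : ℝ) : ℂ)) =ᶠ[nhds u] kerf := by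
      filter_upwards [lt_mem_nhds hu] with v hv
      exact (kerf_eq hv).symm
    refine ContinuousAt.congr ?_ this
    apply Continuous.continuousAt
    fun_prop

lemma perron (a : ℕ → ℂ) {σ x : ℝ} (hσ : 1 ≤ σ) (hx : 0 < x) (ha : LSeriesSummable a σ) :
    ∫ y : ℝ, LSeries a ((σ : ℂ) + y * I) * (x : ℂ) ^ ((σ : ℂ) + y * I) *
        (1 / ((σ : ℂ) + y * I) - 1 / ((σ : ℂ) + y * I + 1)) =
      2 * Real.pi * ∑ n ∈ Icc 1 ⌊x⌋₊, a n * (1 - n / x) := by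
  have hx0 : (x : ℂ) ≠ 0 := by exact_mod_cast hx.ne'
  set F : ℝ → ℂ := fun y => 1 / ((σ : ℂ) + y * I) - 1 / ((σ : ℂ) + y * I + 1) with hF
  set G : ℕ → ℝ → ℂ := fun n y => LSeries.term a ((σ : ℂ) + y * I) n * (x : ℂ) ^ ((σ : ℂ) + y * I) * F y with hG
  have hFi : MeasureTheory.Integrable F := F_int hσ
  have hGnorm : ∀ n y, ‖G n y‖ = ‖LSeries.term a σ n‖ * x ^ σ * ‖F y‖ := by
    intro n y
    simp only [hG, norm_mul]
    rw [norm_cpow_eq_rpow_re_of_pos hx, LSeries.norm_term_eq, LSeries.norm_term_eq]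
    simp
  have hGi : ∀ n, MeasureTheory.Integrable (G n) := by
    intro n
    have hb : ∀ y : ℝ, ‖LSeries.term a ((σ : ℂ) + y * I) n * (x : ℂ) ^ ((σ : ℂ) + y * I)‖ ≤
        ‖LSeries.term a σ n‖ * x ^ σ := by
      intro y
      rw [norm_mul, norm_cpow_eq_rpow_re_of_pos hx, LSeries.norm_term_eq, LSeries.norm_term_eq]
      simp
    refine hFi.bdd_mul (c := ‖LSeries.term a σ n‖ * x ^ σ) ?_ (Eventually.of_forall hb)
    apply Continuous.aestronglyMeasurable
    refine Continuous.mul ?_ ?_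
    · rcases eq_or_ne n 0 with rfl | hn
      · simpa using continuous_const
      · simp_rw [LSeries.term_of_ne_zero hn]
        have hn0 : (n : ℂ) ≠ 0 := by exact_mod_cast hn
        refine Continuous.div continuous_const ?_ ?_
        · exact Continuous.const_cpow (by fun_prop) (Or.inl hn0)
        · intro y
          simp [hn0, cpow_eq_zero_iff]
    · exact Continuous.const_cpow (by fun_prop) (Or.inl hx0)
  have hsum : Summable (fun n => ∫ y, ‖G n y‖) := by
    simp_rw [hGnorm]
    simp_rw [MeasureTheory.integral_const_mul]
    exact (ha.norm.mul_right _).mul_right _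
  have hS := MeasureTheory.hasSum_integral_of_summable_integral_norm hGi hsum
  have hGint : ∀ n, ∫ y, G n y = if n = 0 then 0 else a n * (2 * Real.pi * ((max 0 (1 - n / x) : ℝ) : ℂ)) := by
    intro n
    split_ifs with hn
    · simp [hG, hn]
    · have hnx : 0 < (n : ℝ) / x := div_pos (by exact_mod_cast Nat.pos_of_ne_zero hn) hx
      rw [← kerf_inv hσ hnx, ← MeasureTheory.integral_const_mul]
      congr 1
      ext y
      simp only [hG, hF]
      rw [LSeries.term_of_ne_zero hn]
      have : (((n : ℝ) / x : ℝ) : ℂ) ^ (-((σ : ℂ) + y * I)) =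
          (x : ℂ) ^ ((σ : ℂ) + y * I) / (n : ℂ) ^ ((σ : ℂ) + y * I) := by
        rw [cpow_neg, ofReal_div, Complex.div_cpow_ofReal_nonneg (by positivity) hx.le, inv_div, ofReal_natCast]
      rw [this]; ring
  have hL : ∫ y, ∑' n, G n y = ∫ y : ℝ, LSeries a ((σ : ℂ) + y * I) * (x : ℂ) ^ ((σ : ℂ) + y * I) * F y := by
    congr 1
    ext y
    simp only [hG]
    rw [tsum_mul_right, tsum_mul_right]
    rfl
  rw [← hL, ← hS.tsum_eq, tsum_eq_sum (s := Icc 1 ⌊x⌋₊), mul_sum]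
  · refine sum_congr rfl fun n hn => ?_
    rw [mem_Icc] at hn
    have hnx : (n : ℝ) ≤ x := (Nat.le_floor_iff hx.le).mp hn.2
    rw [hGint, if_neg (by omega), max_eq_right]
    · push_cast; ring
    · rw [sub_nonneg, div_le_one hx]; exact hnx
  · intro n hn
    rw [hGint]
    split_ifs with h0
    · rfl
    · rw [mem_Icc, not_and] at hn
      have hnx : x < n := (Nat.floor_lt hx.le).mp (not_le.mp (hn (by omega)))
      rw [max_eq_left]
      · simp
      · rw [sub_nonpos, one_le_div hx]; exact hnx.le

lemma logMul_iter (k n : ℕ) : (LSeries.logMul^[k] lam) n = ((liouville n * Real.log n ^ k : ℝ) : ℂ) := by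
  induction k generalizing n with
  | zero => simp [lam]
  | succ k ih =>
    rw [Function.iterate_succ_apply', LSeries.logMul, ih, ← Complex.natCast_log]
    push_cast; ring

lemma smooth_bound (k : ℕ) : ∃ C : ℝ, 0 < C ∧ ∀ x : ℝ, 0 < x →
    |∑ n ∈ Icc 1 ⌊x⌋₊, liouville n * Real.log n ^ k * (x - n)| ≤ C * x ^ 2 := by
  obtain ⟨C, hC, h⟩ := lam_LSeries_bound k
  have hJi : MeasureTheory.Integrable (fun y : ℝ => (1 + ‖y‖) ^ (-(3/2 : ℝ))) :=
    integrable_one_add_norm (by simp; norm_num)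
  set J := ∫ y : ℝ, (1 + ‖y‖) ^ (-(3/2 : ℝ)) with hJ
  have hJ0 : 0 ≤ J := MeasureTheory.integral_nonneg fun y => by positivity
  refine ⟨2 * C * J + 1, by positivity, fun x hx => ?_⟩
  set S := ∑ n ∈ Icc 1 ⌊x⌋₊, liouville n * Real.log n ^ k * (x - n) with hS
  have hb : ∀ σ : ℝ, 1 < σ → σ ≤ 2 → |S| ≤ 2 * C * J * x * x ^ σ := by
    intro σ h1 h2
    have hp := perron (LSeries.logMul^[k] lam) h1.le hx (h σ (by simpa using h1) (by simpa using h2)).1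
    have e : ∑ n ∈ Icc 1 ⌊x⌋₊, (LSeries.logMul^[k] lam) n * (1 - n / x) = ((S / x : ℝ) : ℂ) := by
      rw [hS, sum_div]
      push_cast
      refine sum_congr rfl fun n _ => ?_
      rw [logMul_iter]
      have : (x : ℂ) ≠ 0 := by exact_mod_cast hx.ne'
      push_cast
      field_simp
    rw [e] at hp
    have hn : ‖(2 * Real.pi * ((S / x : ℝ) : ℂ) : ℂ)‖ ≤ 2 * C * x ^ σ * J := by
      rw [← hp, hJ, ← MeasureTheory.integral_const_mul]
      refine MeasureTheory.norm_integral_le_of_norm_le (hJi.const_mul _) (Eventually.of_forall fun y => ?_)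
      have q1 := (h ((σ : ℂ) + y * I) (by simpa using h1) (by simpa using h2)).2
      have q2 := F_norm (s := (σ : ℂ) + y * I) (by simpa using h1.le)
      have im1 : ((σ : ℂ) + y * I).im = y := by simp
      rw [im1] at q1 q2
      rw [norm_mul, norm_mul, norm_cpow_eq_rpow_re_of_pos hx]
      have re1 : ((σ : ℂ) + y * I).re = σ := by simp
      rw [re1]
      calc _ ≤ (C * (1 + |y|) ^ (1 / 2 : ℝ)) * x ^ σ * (2 * (1 + ‖y‖) ^ (-(2:ℝ))) := by gcongr
        _ = 2 * C * x ^ σ * ((1 + ‖y‖) ^ (1 / 2 : ℝ) * (1 + ‖y‖) ^ (-(2:ℝ))) := by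
          rw [Real.norm_eq_abs]; ring
        _ = 2 * C * x ^ σ * (1 + ‖y‖) ^ (-(3/2 : ℝ)) := by
          rw [← Real.rpow_add (by positivity)]; norm_num
    rw [norm_mul, norm_mul, norm_real, norm_real, norm_ofNat, Real.norm_eq_abs, Real.norm_eq_abs,
      abs_of_pos Real.pi_pos, abs_div, abs_of_pos hx] at hn
    have hpi : 1 ≤ 2 * Real.pi := by linarith [Real.pi_gt_three]
    have h3 : |S| / x ≤ 2 * C * x ^ σ * J :=
      (le_mul_of_one_le_left (by positivity) hpi).trans hn
    rw [div_le_iff₀ hx] at h3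
    linarith
  have hlim : Tendsto (fun σ : ℝ => 2 * C * J * x * x ^ σ) (nhdsWithin 1 (Set.Ioi 1)) (nhds (2 * C * J * x * x ^ (1:ℝ))) := by
    apply Tendsto.mono_left _ nhdsWithin_le_nhds
    apply Tendsto.const_mul
    exact (Real.continuousAt_const_rpow hx.ne').tendsto
  have hfin : |S| ≤ 2 * C * J * x * x ^ (1:ℝ) := by
    refine ge_of_tendsto hlim ?_
    filter_upwards [Ioc_mem_nhdsGT (by norm_num : (1:ℝ) < 2)] with σ hσ
    exact hb σ hσ.1 hσ.2
  rw [Real.rpow_one] at hfin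
  nlinarith [sq_nonneg x]

end SelbergEx

namespace SelbergEx
open Complex

lemma log_pow_le {B ε : ℝ} (hB : 0 < B) (hε : 0 < ε) : ∃ K : ℝ, 0 < K ∧ ∀ x : ℝ, 1 ≤ x →
    (1 + Real.log x) ^ B ≤ K * x ^ ε := by
  refine ⟨(1 + B / ε) ^ B, by positivity, fun x hx => ?_⟩
  have hx0 : 0 < x := by linarith
  have hl := Real.log_nonneg hx
  have h1 : Real.log x ≤ (B / ε) * x ^ (ε / B) := by
    have h2 := Real.log_le_self (x := x ^ (ε / B)) (by positivity)
    rw [Real.log_rpow hx0] at h2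
    calc Real.log x = (B / ε) * (ε / B * Real.log x) := by field_simp
      _ ≤ _ := by gcongr
  have h3 : 1 ≤ x ^ (ε / B) := Real.one_le_rpow hx (by positivity)
  have h4 : 1 + Real.log x ≤ (1 + B / ε) * x ^ (ε / B) := by linarith
  calc (1 + Real.log x) ^ B ≤ ((1 + B / ε) * x ^ (ε / B)) ^ B :=
        Real.rpow_le_rpow (by linarith) h4 hB.le
    _ = (1 + B / ε) ^ B * x ^ ε := by
        rw [Real.mul_rpow (by positivity) (by positivity), ← Real.rpow_mul hx0.le]
        congr 2
        field_simp

lemma unsmooth (a : ℕ → ℝ) (x h Y : ℝ) (hx : 0 ≤ x) (hh : 0 ≤ h)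
    (ha : ∀ n ∈ Ioc ⌊x⌋₊ ⌊x + h⌋₊, |a n| ≤ Y) (hY : 0 ≤ Y) :
    h * |∑ n ∈ Icc 1 ⌊x⌋₊, a n| ≤ |∑ n ∈ Icc 1 ⌊x + h⌋₊, a n * (x + h - n)| +
      |∑ n ∈ Icc 1 ⌊x⌋₊, a n * (x - n)| + (h + 1) * (Y * h) := by
  have hle : ⌊x⌋₊ ≤ ⌊x + h⌋₊ := Nat.floor_mono (by linarith)
  have hdisj : ∑ n ∈ Icc 1 ⌊x + h⌋₊, a n * (x + h - n) =
      ∑ n ∈ Icc 1 ⌊x⌋₊, a n * (x + h - n) + ∑ n ∈ Ioc ⌊x⌋₊ ⌊x + h⌋₊, a n * (x + h - n) := by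
    rw [← sum_union]
    · congr 1
      ext n; simp only [mem_Icc, mem_union, mem_Ioc]; omega
    · rw [disjoint_left]
      intro n; simp only [mem_Icc, mem_Ioc]; omega
  have e : ∑ n ∈ Icc 1 ⌊x⌋₊, a n * (x + h - n) =
      ∑ n ∈ Icc 1 ⌊x⌋₊, a n * (x - n) + h * ∑ n ∈ Icc 1 ⌊x⌋₊, a n := by
    rw [mul_sum, ← sum_add_distrib]
    exact sum_congr rfl fun n _ => by ring
  have hb : |∑ n ∈ Ioc ⌊x⌋₊ ⌊x + h⌋₊, a n * (x + h - n)| ≤ (h + 1) * (Y * h) := by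
    refine (abs_sum_le_sum_abs _ _).trans ?_
    calc _ ≤ ∑ n ∈ Ioc ⌊x⌋₊ ⌊x + h⌋₊, Y * h := by
          refine sum_le_sum fun n hn => ?_
          rw [abs_mul]
          have h1 := ha n hn
          rw [mem_Ioc] at hn
          have h2 : x < n := (Nat.floor_lt hx).mp hn.1
          have h3 : (n : ℝ) ≤ x + h := (Nat.le_floor_iff (by linarith)).mp hn.2
          have h4 : |x + h - n| ≤ h := by rw [abs_le]; constructor <;> linarith
          gcongr
      _ = ((⌊x + h⌋₊ : ℝ) - ⌊x⌋₊) * (Y * h) := by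
          rw [sum_const, Nat.card_Ioc, nsmul_eq_mul, Nat.cast_sub hle]
      _ ≤ _ := by
          have h1 := Nat.floor_le (show 0 ≤ x + h by linarith)
          have h2 := Nat.lt_floor_add_one x
          gcongr
          linarith
  have key : h * ∑ n ∈ Icc 1 ⌊x⌋₊, a n = ∑ n ∈ Icc 1 ⌊x + h⌋₊, a n * (x + h - n) -
      ∑ n ∈ Icc 1 ⌊x⌋₊, a n * (x - n) - ∑ n ∈ Ioc ⌊x⌋₊ ⌊x + h⌋₊, a n * (x + h - n) := by
    rw [hdisj, e]; ring
  rw [← abs_of_nonneg hh, ← abs_mul, abs_of_nonneg hh, key]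
  refine (abs_sub _ _).trans ?_
  have := abs_sub (∑ n ∈ Icc 1 ⌊x + h⌋₊, a n * (x + h - n)) (∑ n ∈ Icc 1 ⌊x⌋₊, a n * (x - n))
  linarith

lemma A_bound (m : ℕ) : ∃ C : ℝ, 0 < C ∧ ∀ x : ℝ, 1 ≤ x →
    |∑ n ∈ Icc 1 ⌊x⌋₊, liouville n * Real.log n ^ (2 * m)| ≤ C * x * (1 + Real.log x) ^ m := by
  obtain ⟨C, hC, hS⟩ := smooth_bound (2 * m)
  obtain ⟨K, hK, hl⟩ := log_pow_le (B := m + 1) (ε := 1) (by positivity) one_pos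
  refine ⟨5 * C + 1 + K, by positivity, fun x hx => ?_⟩
  have hx0 : 0 < x := by linarith
  have hlx := Real.log_nonneg hx
  set l := 1 + Real.log x with hldef
  have hl1 : 1 ≤ l := by linarith
  have hlm : 1 ≤ l ^ m := one_le_pow₀ hl1
  have hlK : l ^ m ≤ K * x := by
    have := hl x hx
    rw [Real.rpow_one] at this
    refine le_trans ?_ this
    calc l ^ m ≤ l ^ (m + 1) := pow_le_pow_right₀ hl1 (by omega)
      _ = _ := by rw [← Real.rpow_natCast]; push_cast; rfl
  set h := x / l ^ m with hh
  have hh0 : 0 < h := by positivity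
  have hhx : h ≤ x := div_le_self hx0.le hlm
  have hu := unsmooth (fun n => liouville n * Real.log n ^ (2 * m)) x h (l ^ (2 * m)) hx0.le hh0.le
    (fun n hn => by
      rw [mem_Ioc] at hn
      have h2 : x < n := (Nat.floor_lt hx0.le).mp hn.1
      have h3 : (n : ℝ) ≤ x + h := (Nat.le_floor_iff (by linarith)).mp hn.2
      have h4 : 0 ≤ Real.log n := Real.log_nonneg (by linarith)
      have h5 : Real.log n ≤ l := by
        calc Real.log n ≤ Real.log (2 * x) := Real.log_le_log (by linarith) (by linarith)
          _ = Real.log 2 + Real.log x := Real.log_mul (by norm_num) hx0.ne'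
          _ ≤ l := by have := Real.log_two_lt_d9; linarith
      rw [abs_mul, abs_liouville, one_mul, abs_of_nonneg (by positivity)]
      gcongr) (by positivity)
  have s1 := hS x hx0
  have s2 := hS (x + h) (by linarith)
  have s3 : (x + h) ^ 2 ≤ 4 * x ^ 2 := by nlinarith
  set A := |∑ n ∈ Icc 1 ⌊x⌋₊, liouville n * Real.log n ^ (2 * m)| with hA
  have hhl : h * l ^ m = x := by rw [hh]; field_simp
  have h1 : h * A ≤ 5 * C * x ^ 2 + (h + 1) * (l ^ (2 * m) * h) := by
    have : C * (x + h) ^ 2 ≤ C * (4 * x ^ 2) := by gcongr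
    linarith
  have h2 : h * A ≤ h * (5 * C * x * l ^ m + (h + 1) * l ^ (2 * m)) := by
    calc _ ≤ _ := h1
      _ = 5 * C * x * (h * l ^ m) + (h + 1) * (l ^ (2 * m) * h) := by rw [hhl]; ring
      _ = _ := by ring
  have h3 := le_of_mul_le_mul_left h2 hh0
  calc A ≤ _ := h3
    _ = 5 * C * x * l ^ m + (h * l ^ m) * l ^ m + l ^ m * l ^ m := by ring
    _ ≤ 5 * C * x * l ^ m + x * l ^ m + (K * x) * l ^ m := by rw [hhl]; gcongr
    _ = _ := by ring

lemma abel_ineq (f g : ℕ → ℝ) (M N : ℕ) (D : ℝ) (hMN : M + 1 ≤ N)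
    (hF : ∀ j, j ≤ N → |∑ n ∈ Ioc M j, f n| ≤ D)
    (hg : ∀ n, M + 1 ≤ n → 0 ≤ g n) (hg' : ∀ n, M + 1 ≤ n → g (n + 1) ≤ g n) :
    |∑ n ∈ Ioc M N, f n * g n| ≤ D * g (M + 1) := by
  have key : ∀ j, M + 1 ≤ j → j ≤ N →
      |∑ n ∈ Ioc M j, f n * g n - (∑ n ∈ Ioc M j, f n) * g j| ≤ D * (g (M + 1) - g j) := by
    intro j hj
    induction j, hj using Nat.le_induction with
    | base => intro _; simp
    | succ j hj ih =>
      intro hjN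
      have ih' := ih (by omega)
      rw [sum_Ioc_succ_top (by omega), sum_Ioc_succ_top (by omega)]
      have e : ∑ n ∈ Ioc M j, f n * g n + f (j + 1) * g (j + 1) -
          (∑ n ∈ Ioc M j, f n + f (j + 1)) * g (j + 1) =
          (∑ n ∈ Ioc M j, f n * g n - (∑ n ∈ Ioc M j, f n) * g j) +
          (∑ n ∈ Ioc M j, f n) * (g j - g (j + 1)) := by ring
      rw [e]
      refine (abs_add_le _ _).trans ?_
      have h1 : |(∑ n ∈ Ioc M j, f n) * (g j - g (j + 1))| ≤ D * (g j - g (j + 1)) := by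
        have := hg' j hj
        rw [abs_mul, abs_of_nonneg (a := g j - g (j + 1)) (by linarith)]
        exact mul_le_mul_of_nonneg_right (hF j (by omega)) (by linarith)
      linarith
  have k1 := key N hMN le_rfl
  have k2 : |(∑ n ∈ Ioc M N, f n) * g N| ≤ D * g N := by
    rw [abs_mul, abs_of_nonneg (hg N hMN)]
    exact mul_le_mul_of_nonneg_right (hF N le_rfl) (hg N hMN)
  have := abs_add_le (∑ n ∈ Ioc M N, f n * g n - (∑ n ∈ Ioc M N, f n) * g N) ((∑ n ∈ Ioc M N, f n) * g N)
  rw [sub_add_cancel] at this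
  linarith

lemma L_triv {x : ℝ} (hx : 0 ≤ x) : |∑ n ∈ Icc 1 ⌊x⌋₊, liouville n| ≤ x := by
  refine (abs_sum_le_sum_abs _ _).trans ?_
  simp only [abs_liouville, sum_const, Nat.card_Icc, nsmul_eq_mul, mul_one, add_tsub_cancel_right]
  exact Nat.floor_le hx

lemma L_bound (m : ℕ) : ∃ C : ℝ, 0 < C ∧ ∀ x : ℝ, 1 ≤ x →
    |∑ n ∈ Icc 1 ⌊x⌋₊, liouville n| ≤ C * x / (1 + Real.log x) ^ m := by
  obtain ⟨C, hC, hA⟩ := A_bound m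
  obtain ⟨K, hK, hl⟩ := log_pow_le (B := m + 1) (ε := 1 / 2) (by positivity) (by norm_num)
  refine ⟨3 ^ m + (K + 2 * C * 16 ^ m), by positivity, fun x hx => ?_⟩
  have hx0 : 0 < x := by linarith
  have hlx := Real.log_nonneg hx
  set l := 1 + Real.log x with hldef
  have hl1 : 1 ≤ l := by linarith
  have hl0 : 0 < l := by linarith
  rcases lt_or_ge x 3 with h3 | h3
  · have hl3 : l ≤ 3 := by
      have := Real.log_le_sub_one_of_pos hx0
      linarith
    calc _ ≤ x := L_triv hx0.le
      _ ≤ 3 ^ m * x / l ^ m := by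
        rw [le_div_iff₀ (by positivity), mul_comm]
        gcongr
      _ ≤ _ := by
        gcongr
        have : 0 ≤ K + 2 * C * 16 ^ m := by positivity
        linarith
  · have hlog1 : 1 ≤ Real.log x := by
      rw [Real.le_log_iff_exp_le hx0]
      linarith [Real.exp_one_lt_d9]
    have hsq1 : 1 < Real.sqrt x := by
      rw [Real.lt_sqrt (by norm_num)]; linarith
    have hsqx : Real.sqrt x < x := by
      rw [Real.sqrt_lt' hx0]; nlinarith
    set M := ⌊Real.sqrt x⌋₊ with hM
    set N := ⌊x⌋₊ with hN
    have hM1 : 1 ≤ M := Nat.le_floor (by simpa using hsq1.le)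
    have hMN : M ≤ N := Nat.floor_mono hsqx.le
    have hsplit : ∀ (f : ℕ → ℝ) (j : ℕ), M ≤ j → ∑ n ∈ Icc 1 j, f n =
        ∑ n ∈ Icc 1 M, f n + ∑ n ∈ Ioc M j, f n := by
      intro f j hj
      rw [← sum_union]
      · congr 1
        ext n; simp only [mem_Icc, mem_union, mem_Ioc]; omega
      · rw [disjoint_left]
        intro n; simp only [mem_Icc, mem_Ioc]; omega
    have hAj : ∀ j : ℕ, j ≤ N → 1 ≤ j →
        |∑ n ∈ Icc 1 j, liouville n * Real.log n ^ (2 * m)| ≤ C * x * l ^ m := by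
      intro j hj hj1
      have h := hA j (by exact_mod_cast hj1)
      rw [Nat.floor_natCast] at h
      have hjx : (j : ℝ) ≤ x := (Nat.le_floor_iff hx0.le).mp hj
      have hj1' : (1 : ℝ) ≤ j := by exact_mod_cast hj1
      have hlj : 0 ≤ Real.log j := Real.log_nonneg hj1'
      refine h.trans ?_
      have : Real.log j ≤ Real.log x := Real.log_le_log (by linarith) hjx
      rw [hldef]
      gcongr
    have hmain : |∑ n ∈ Ioc M N, liouville n| ≤ 2 * C * 16 ^ m * x / l ^ m := by
      rcases hMN.eq_or_lt with heq | hlt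
      · rw [heq]; simp; positivity
      have hab := abel_ineq (fun n => liouville n * Real.log n ^ (2 * m)) (fun n => 1 / Real.log n ^ (2 * m))
        M N (2 * (C * x * l ^ m)) hlt (fun j hj => by
          rcases le_or_gt M j with hMj | hMj
          · have e := hsplit (fun n => liouville n * Real.log n ^ (2 * m)) j hMj
            have e1 := hAj j hj (by omega)
            have e2 := hAj M hMN hM1
            have e3 := abs_sub (∑ n ∈ Icc 1 j, liouville n * Real.log n ^ (2 * m))
              (∑ n ∈ Icc 1 M, liouville n * Real.log n ^ (2 * m))
            rw [e] at e3 e1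
            rw [add_sub_cancel_left] at e3
            linarith
          · rw [Ioc_eq_empty (by omega)]; simp; positivity)
        (fun n hn => by
          have : 0 ≤ Real.log n := Real.log_natCast_nonneg n
          positivity)
        (fun n hn => by
          have hn2 : (1 : ℝ) < n := by
            have : 1 < n := by omega
            exact_mod_cast this
          have : 0 < Real.log n := Real.log_pos hn2
          have : Real.log n ≤ Real.log (n + 1 : ℕ) := Real.log_le_log (by linarith) (by push_cast; linarith)
          gcongr)
      have e : ∑ n ∈ Ioc M N, liouville n * Real.log n ^ (2 * m) * (1 / Real.log n ^ (2 * m)) =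
          ∑ n ∈ Ioc M N, liouville n := by
        refine sum_congr rfl fun n hn => ?_
        rw [mem_Ioc] at hn
        have hn2 : (1 : ℝ) < n := by
          have : 1 < n := by omega
          exact_mod_cast this
        have : 0 < Real.log n := Real.log_pos hn2
        field_simp
      rw [e] at hab
      refine hab.trans ?_
      have hq : l / 4 ≤ Real.log (M + 1 : ℕ) := by
        have : Real.log (Real.sqrt x) ≤ Real.log (M + 1 : ℕ) :=
          Real.log_le_log (by linarith) (by push_cast; exact (Nat.lt_floor_add_one _).le)
        rw [Real.log_sqrt hx0.le] at this
        linarith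
      calc _ ≤ 2 * (C * x * l ^ m) * (1 / (l / 4) ^ (2 * m)) := by gcongr
        _ = _ := by
          rw [div_pow, show (4:ℝ) ^ (2 * m) = 16 ^ m by rw [pow_mul]; norm_num,
            show l ^ (2 * m) = l ^ m * l ^ m by rw [← pow_add]; congr 1; omega]
          field_simp
    have hsmall : Real.sqrt x ≤ K * x / l ^ m := by
      have h1 := hl x hx
      have h2 : l ^ m ≤ K * Real.sqrt x := by
        rw [Real.sqrt_eq_rpow]
        refine le_trans ?_ h1
        calc l ^ m ≤ l ^ (m + 1) := pow_le_pow_right₀ hl1 (by omega)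
          _ = _ := by rw [← Real.rpow_natCast]; push_cast; rfl
      rw [le_div_iff₀ (by positivity)]
      calc Real.sqrt x * l ^ m ≤ Real.sqrt x * (K * Real.sqrt x) := by gcongr
        _ = K * (Real.sqrt x * Real.sqrt x) := by ring
        _ = K * x := by rw [Real.mul_self_sqrt hx0.le]
    rw [hsplit _ N hMN]
    calc _ ≤ Real.sqrt x + 2 * C * 16 ^ m * x / l ^ m :=
          (abs_add_le _ _).trans (add_le_add (L_triv (Real.sqrt_nonneg x)) hmain)
      _ ≤ K * x / l ^ m + 2 * C * 16 ^ m * x / l ^ m := by gcongr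
      _ = (K + 2 * C * 16 ^ m) * x / l ^ m := by ring
      _ ≤ _ := by
        have : (0:ℝ) ≤ 3 ^ m := by positivity
        exact div_le_div_of_nonneg_right (mul_le_mul_of_nonneg_right (by linarith) hx0.le) (by positivity)

end SelbergEx

namespace SelbergEx
open Complex

lemma sum_dvd (f : ℕ → ℝ) {x : ℝ} {d : ℕ} (hd : 1 ≤ d) :
    ∑ n ∈ (Icc 1 ⌊x⌋₊).filter (fun n => d ∣ n), f n = ∑ k ∈ Icc 1 ⌊x / d⌋₊, f (d * k) := by
  rw [Nat.floor_div_natCast]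
  symm
  refine sum_nbij' (fun k => d * k) (fun n => n / d) ?_ ?_ ?_ ?_ ?_
  · intro k hk
    rw [mem_Icc] at hk
    rw [mem_filter, mem_Icc]
    refine ⟨⟨Nat.mul_pos hd hk.1, ?_⟩, dvd_mul_right _ _⟩
    rw [mul_comm]
    exact (Nat.le_div_iff_mul_le hd).mp hk.2
  · intro n hn
    rw [mem_filter, mem_Icc] at hn
    rw [mem_Icc]
    exact ⟨Nat.div_pos (Nat.le_of_dvd hn.1.1 hn.2) hd, Nat.div_le_div_right hn.1.2⟩
  · intro k _
    exact Nat.mul_div_cancel_left k hd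
  · intro n hn
    rw [mem_filter] at hn
    exact Nat.mul_div_cancel' hn.2
  · intro k _
    rfl

lemma term_bound {x : ℝ} (hx : 0 ≤ x) {d : ℕ} (hd : 1 ≤ d) :
    |(∑ n ∈ (Icc 1 ⌊x⌋₊).filter (fun n => d ∣ n), (1 + liouville n)) - x / d| ≤
      1 + |∑ n ∈ Icc 1 ⌊x / d⌋₊, liouville n| := by
  rw [sum_dvd _ hd, sum_add_distrib]
  have e : ∑ k ∈ Icc 1 ⌊x / d⌋₊, liouville (d * k) = liouville d * ∑ k ∈ Icc 1 ⌊x / d⌋₊, liouville k := by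
    rw [mul_sum]
    refine sum_congr rfl fun k hk => ?_
    rw [mem_Icc] at hk
    exact liouville_mul d k (by omega) (by omega)
  rw [e]
  simp only [sum_const, Nat.card_Icc, nsmul_eq_mul, mul_one, add_tsub_cancel_right]
  have h0 : 0 ≤ x / d := by positivity
  have h1 := Nat.floor_le h0
  have h2 := Nat.lt_floor_add_one (x / d)
  have h3 : |(⌊x / d⌋₊ : ℝ) - x / d| ≤ 1 := by rw [abs_le]; constructor <;> linarith
  have h4 : |liouville d * ∑ k ∈ Icc 1 ⌊x / d⌋₊, liouville k| = |∑ k ∈ Icc 1 ⌊x / d⌋₊, liouville k| := by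
    rw [abs_mul, abs_liouville, one_mul]
  rw [← h4, add_sub_right_comm]
  exact (abs_add_le _ _).trans (by linarith)

lemma part_a (ν : ℝ) (hν : ν ∈ Set.Ioo (0 : ℝ) 1) : Rcond ν (fun n => 1 + liouville n) := by
  intro B hB
  obtain ⟨hν0, hν1⟩ := hν
  obtain ⟨m, hm⟩ := exists_nat_ge (B + 1)
  obtain ⟨C, hC, hL⟩ := L_bound m
  obtain ⟨K, hK, hl⟩ := log_pow_le (B := B) (ε := 1 - ν) hB (by linarith)
  have hν' : 0 < 1 - ν := by linarith
  refine ⟨K + C / (1 - ν) ^ m, fun x hx => ?_⟩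
  have hx0 : 0 < x := by linarith
  have hx1 : 1 ≤ x := by linarith
  have hlx : 0 < Real.log x := Real.log_pos (by linarith)
  set l := 1 + Real.log x with hldef
  have hl1 : 1 ≤ l := by linarith
  have hl0 : 0 < l := by linarith
  have hxν : 1 ≤ x ^ ν := Real.one_le_rpow hx1 hν0.le
  have hterm : ∀ d ∈ Icc 1 ⌊x ^ ν⌋₊,
      |(∑ n ∈ (Icc 1 ⌊x⌋₊).filter (fun n => d ∣ n), (1 + liouville n)) - x / d| ≤
      1 + (C / (1 - ν) ^ m * x / l ^ m) * (d : ℝ)⁻¹ := by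
    intro d hd
    rw [mem_Icc] at hd
    refine (term_bound hx0.le hd.1).trans ?_
    have hd0 : (1:ℝ) ≤ d := by exact_mod_cast hd.1
    have hdx : (d : ℝ) ≤ x ^ ν := (Nat.le_floor_iff (by positivity)).mp hd.2
    have hy : x ^ (1 - ν) ≤ x / d := by
      rw [Real.rpow_sub hx0, Real.rpow_one]
      gcongr
    have hy1 : 1 ≤ x / d := (Real.one_le_rpow hx1 hν'.le).trans hy
    have hly : (1 - ν) * l ≤ 1 + Real.log (x / d) := by
      have := Real.log_le_log (by positivity) hy
      rw [Real.log_rpow hx0] at this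
      rw [hldef]
      linarith
    have h1 := hL (x / d) hy1
    have h2 : C * (x / d) / (1 + Real.log (x / d)) ^ m ≤ C * (x / d) / ((1 - ν) * l) ^ m := by
      gcongr
    have h3 : C * (x / d) / ((1 - ν) * l) ^ m = (C / (1 - ν) ^ m * x / l ^ m) * (d : ℝ)⁻¹ := by
      rw [mul_pow]
      field_simp
    linarith
  have hharm : ∑ d ∈ Icc 1 ⌊x ^ ν⌋₊, (d : ℝ)⁻¹ ≤ l := by
    have h := harmonic_floor_le_one_add_log (x ^ ν) hxν
    rw [harmonic_eq_sum_Icc] at h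
    push_cast at h
    rw [Real.log_rpow hx0] at h
    refine h.trans ?_
    rw [hldef]
    nlinarith
  have hlB : l ^ (-B) ≤ Real.log x ^ (-B) :=
    Real.rpow_le_rpow_of_nonpos hlx (by linarith) (by linarith)
  have h1 : x ^ ν ≤ K * x * l ^ (-B) := by
    have := hl x hx1
    rw [Real.rpow_neg hl0.le, ← div_eq_mul_inv, le_div_iff₀ (by positivity)]
    calc x ^ ν * l ^ B ≤ x ^ ν * (K * x ^ (1 - ν)) := by gcongr
      _ = K * (x ^ ν * x ^ (1 - ν)) := by ring
      _ = K * x := by rw [← Real.rpow_add hx0]; simp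
  have h2 : l / l ^ m ≤ l ^ (-B) := by
    rw [← Real.rpow_natCast]
    nth_rw 1 [← Real.rpow_one l]
    rw [← Real.rpow_sub hl0]
    exact Real.rpow_le_rpow_of_exponent_le hl1 (by linarith)
  calc _ ≤ ∑ d ∈ Icc 1 ⌊x ^ ν⌋₊, (1 + (C / (1 - ν) ^ m * x / l ^ m) * (d : ℝ)⁻¹) :=
        sum_le_sum hterm
    _ = ⌊x ^ ν⌋₊ + (C / (1 - ν) ^ m * x / l ^ m) * ∑ d ∈ Icc 1 ⌊x ^ ν⌋₊, (d : ℝ)⁻¹ := by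
        rw [sum_add_distrib, mul_sum]; simp
    _ ≤ x ^ ν + (C / (1 - ν) ^ m * x / l ^ m) * l := by
        gcongr
        exact Nat.floor_le (by positivity)
    _ = x ^ ν + C / (1 - ν) ^ m * x * (l / l ^ m) := by ring
    _ ≤ K * x * l ^ (-B) + C / (1 - ν) ^ m * x * l ^ (-B) := by gcongr
    _ = (K + C / (1 - ν) ^ m) * x * l ^ (-B) := by ring
    _ ≤ _ := by gcongr

lemma part_b : ∃ C : ℝ, ∀ x : ℝ, 1 ≤ x →
      |∑ n ∈ Finset.Icc 1 ⌊x⌋₊, (1 + liouville n) * ArithmeticFunction.vonMangoldt n|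
        ≤ C * Real.sqrt x := by
  refine ⟨2 * (Real.log 4 + 4), fun x hx => ?_⟩
  have hx0 : 0 ≤ x := by linarith
  have hnn : ∀ n, 0 ≤ (1 + liouville n) * ArithmeticFunction.vonMangoldt n := by
    intro n
    have := abs_le.mp (abs_liouville n).le
    exact mul_nonneg (by linarith [this.1]) ArithmeticFunction.vonMangoldt_nonneg
  rw [abs_of_nonneg (sum_nonneg fun n _ => hnn n)]
  have hsq : ∀ n, (1 + liouville n) * ArithmeticFunction.vonMangoldt n ≠ 0 → ∃ k, n = k ^ 2 := by
    intro n hn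
    have h1 : ArithmeticFunction.vonMangoldt n ≠ 0 := right_ne_zero_of_mul hn
    have h2 : 1 + liouville n ≠ 0 := left_ne_zero_of_mul hn
    rw [ArithmeticFunction.vonMangoldt_ne_zero_iff, isPrimePow_nat_iff] at h1
    obtain ⟨p, j, hp, hj, rfl⟩ := h1
    rcases Nat.even_or_odd j with he | ho
    · obtain ⟨i, rfl⟩ := he
      exact ⟨p ^ i, by ring⟩
    · exfalso
      apply h2
      rw [liouville, ArithmeticFunction.cardFactors_apply_prime_pow hp, ho.neg_one_pow]
      ring
  calc _ ≤ ∑ n ∈ (Icc 0 ⌊Real.sqrt x⌋₊).image (fun k => k ^ 2),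
        (1 + liouville n) * ArithmeticFunction.vonMangoldt n := by
        rw [← sum_filter_ne_zero]
        refine sum_le_sum_of_subset_of_nonneg (fun n hn' => ?_) (fun n _ _ => hnn n)
        rw [mem_filter] at hn'
        obtain ⟨hn, h⟩ := hn'
        obtain ⟨k, rfl⟩ := hsq n h
        rw [mem_image]
        refine ⟨k, ?_, rfl⟩
        rw [mem_Icc] at hn ⊢
        refine ⟨Nat.zero_le _, Nat.le_floor ?_⟩
        have : ((k ^ 2 : ℕ) : ℝ) ≤ x := (Nat.le_floor_iff hx0).mp hn.2
        apply Real.le_sqrt_of_sq_le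
        exact_mod_cast this
    _ = ∑ k ∈ Icc 0 ⌊Real.sqrt x⌋₊, (1 + liouville (k ^ 2)) * ArithmeticFunction.vonMangoldt (k ^ 2) := by
        rw [sum_image]
        intro a _ b _ h
        exact Nat.pow_left_injective two_ne_zero h
    _ ≤ ∑ k ∈ Icc 0 ⌊Real.sqrt x⌋₊, 2 * ArithmeticFunction.vonMangoldt k := by
        refine sum_le_sum fun k _ => ?_
        rw [ArithmeticFunction.vonMangoldt_apply_pow two_ne_zero]
        have := abs_le.mp (abs_liouville (k ^ 2)).le
        exact mul_le_mul_of_nonneg_right (by linarith [this.2]) ArithmeticFunction.vonMangoldt_nonneg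
    _ = 2 * Chebyshev.psi (Real.sqrt x) := by rw [Chebyshev.psi_eq_sum_Icc, mul_sum]
    _ ≤ _ := by
        have := Chebyshev.psi_le_const_mul_self (Real.sqrt_nonneg x)
        linarith

end SelbergEx

/-- Selberg's example.  For `a_n = 1 + λ(n)`:
(a) condition `R(ν)` holds for every `ν ∈ (0,1)`;
(b) `∑_{n ≤ x} a_n Λ(n) = O(√x)`. -/
theorem bombieri_sieve_stmt19 :
    (∀ ν : ℝ, ν ∈ Set.Ioo (0 : ℝ) 1 → Rcond ν (fun n => 1 + liouville n)) ∧
    (∃ C : ℝ, ∀ x : ℝ, 1 ≤ x →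
      |∑ n ∈ Finset.Icc 1 ⌊x⌋₊, (1 + liouville n) * ArithmeticFunction.vonMangoldt n|
        ≤ C * Real.sqrt x) := by
  exact ⟨SelbergEx.part_a, SelbergEx.part_b⟩
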